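/- arXiv:2402.15787 — 3 statements merged into one kernel-verified Lean document; each statement's English description precedes it below -/
import Mathlib

section
/- Let t be a positive integer and let U_t = {(x, y) ∈ ℤ² : y ≥ g_t(x)} be the set of lattice points on or above the grid parabola P_t. If t is odd, then peel^[t](U_t) = {(x, y) ∈ ℤ² : y ≥ g_t(x) + 1}, i.e., after t grid peeling steps the chain P_t repeats one unit higher. If t is even, then peel^[t+1](U_t) = {(x, y) ∈ ℤ² : y ≥ g_t(x) + 1}, i.e., after t+1 grid peeling steps the chain P_t repeats one unit higher. -/
/-- Horizontal length of the edge of slope a/b (in lowest terms, 1 ≤ b ≤ t)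
of the grid parabola P_t: `b·⌊t/b⌋`. -/
def edgeLen (t b : ℕ) : ℕ := b * (t / b)

/-- The x-coordinate of the left endpoint of the edge of slope a/b of the grid
parabola P_t (normalized so that the edge of slope 0 is [0,t]): it is t plus the
total horizontal length of all edges of slopes strictly between 0 and a/b. -/
noncomputable def leftEnd (t a b : ℕ) : ℝ :=
  (t : ℝ) + ∑ q ∈ (Finset.Icc 1 t ×ˢ Finset.Icc 1 (a * t)).filter
      (fun q => Nat.gcd q.2 q.1 = 1 ∧ q.2 * b < a * q.1),
    (edgeLen t q.1 : ℝ)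

/-- The right half of the grid parabola: for x ≥ t, sum over all primitive slopes
a/b (a ≥ 1, 1 ≤ b ≤ t) of the vertical rise accumulated by the edge of slope a/b
up to abscissa x. -/
noncomputable def gR (t : ℕ) (x : ℝ) : ℝ :=
  ∑' p : ℕ × ℕ,
    if 1 ≤ p.1 ∧ 1 ≤ p.2 ∧ p.2 ≤ t ∧ Nat.gcd p.1 p.2 = 1 then
      ((p.1 : ℝ) / (p.2 : ℝ)) *
        min (max (x - leftEnd t p.1 p.2) 0) ((edgeLen t p.2 : ℕ) : ℝ)
    else 0

/-- The convex piecewise-linear function `g_t` whose graph is the grid parabola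
P_t : for each rational slope a/b in lowest terms with 1 ≤ b ≤ t there is exactly
one edge of slope a/b, of horizontal length b·⌊t/b⌋, the edges occurring in order
of increasing slope; normalized so that g_t = 0 exactly on [0,t].  The left half
is obtained from the right half by the symmetry x ↦ t - x. -/
noncomputable def gridParabola (t : ℕ) (x : ℝ) : ℝ :=
  if x ≤ (t : ℝ) / 2 then gR t ((t : ℝ) - x) else gR t x

/-- One grid peeling step: remove the extreme points of the convex hull. -/
noncomputable def peel (U : Set (ℝ × ℝ)) : Set (ℝ × ℝ) :=
  U \ Set.extremePoints ℝ (convexHull ℝ U)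

/-- The lattice points on or above the graph of `g`. -/
def Ugrid (g : ℝ → ℝ) : Set (ℝ × ℝ) :=
  {p | (∃ i j : ℤ, p = ((i : ℝ), (j : ℝ))) ∧ g p.1 ≤ p.2}

namespace GP

def PS (s : ℤ → ℤ) (n : ℤ) : ℤ :=
  ∑ i ∈ Finset.range n.toNat, s i - ∑ i ∈ Finset.range (-n).toNat, s (-1 - i)

lemma PS_zero (s : ℤ → ℤ) : PS s 0 = 0 := by simp [PS]

lemma PS_succ (s : ℤ → ℤ) (n : ℤ) : PS s (n + 1) = PS s n + s n := by
  unfold PS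
  rcases le_or_gt 0 n with h | h
  · obtain ⟨k, rfl⟩ := Int.eq_ofNat_of_zero_le h
    have e1 : ((k : ℤ) + 1).toNat = k + 1 := by omega
    have e2 : (-((k : ℤ) + 1)).toNat = 0 := by omega
    have e3 : (-(k : ℤ)).toNat = 0 := by omega
    have e4 : ((k : ℤ)).toNat = k := by omega
    rw [e1, e2, e3, e4, Finset.sum_range_succ]
    simp
  · obtain ⟨k, hk⟩ := Int.eq_ofNat_of_zero_le (show 0 ≤ -n - 1 by omega)
    have e1 : (n + 1).toNat = 0 := by omega
    have e2 : (-(n + 1)).toNat = k := by omega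
    have e3 : (-n).toNat = k + 1 := by omega
    have e4 : n.toNat = 0 := by omega
    rw [e1, e2, e3, e4, Finset.sum_range_succ]
    have : n = -1 - (k : ℤ) := by omega
    rw [← this]; simp

lemma PS_add (s : ℤ → ℤ) (m : ℤ) (n : ℕ) :
    PS s (m + n) = PS s m + ∑ i ∈ Finset.range n, s (m + i) := by
  induction n with
  | zero => simp
  | succ n ih =>
    rw [Finset.sum_range_succ, ← add_assoc, ← ih, ← PS_succ]
    push_cast; ring_nf

open Classical in
lemma base (n : ℕ) (hn : 0 < n) (e x1 M : ℤ) :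
    ∑ x ∈ Finset.range n, (1 + (x1 + x) * e / n + (M - (x1 + x)) * e / n)
      = M * e + ((Finset.range n).filter (fun x : ℕ => (n : ℤ) ∣ (x1 + x) * e)).card := by
  have hn' : (0 : ℤ) < n := by exact_mod_cast hn
  have step : ∀ M : ℤ, ∑ x ∈ Finset.range n, (1 + (x1 + x) * e / n + (M + 1 - (x1 + x)) * e / n)
      = ∑ x ∈ Finset.range n, (1 + (x1 + x) * e / n + (M - (x1 + x)) * e / n) + e := by
    intro M
    rw [← sub_eq_iff_eq_add', ← Finset.sum_sub_distrib]
    have := Finset.sum_range_sub' (fun x : ℕ => (M + 1 - (x1 + x)) * e / n) n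
    have h2 : (M + 1 - (x1 + (0 : ℕ))) * e / n - (M + 1 - (x1 + n)) * e / n = e := by
      have : (M + 1 - (x1 + (0 : ℕ))) * e = (M + 1 - (x1 + n)) * e + e * n := by push_cast; ring
      rw [this, Int.add_mul_ediv_right _ _ hn'.ne']; ring
    rw [h2] at this
    refine (Finset.sum_congr rfl ?_).trans this
    intro x _
    have : M + 1 - (x1 + ((x + 1 : ℕ) : ℤ)) = M - (x1 + x) := by push_cast; ring
    rw [this]; ring
  have key : ∀ M : ℤ, ∑ x ∈ Finset.range n, (1 + (x1 + x) * e / n + (M - (x1 + x)) * e / n)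
      = M * e + ∑ x ∈ Finset.range n, (1 + (x1 + x) * e / n + (0 - (x1 + x)) * e / n) := by
    intro M
    induction M using Int.induction_on with
    | zero => simp
    | succ i ih => rw [step, ih]; ring
    | pred i ih =>
      have := step (-(i : ℤ) - 1)
      rw [sub_add_cancel, ih] at this
      linarith
  rw [key, Finset.card_filter]
  push_cast
  congr 1
  apply Finset.sum_congr rfl
  intro x _
  generalize (x1 + (x : ℤ)) = w
  have : (0 - w) * e = - (w * e) := by ring
  rw [this]
  generalize w * e = z
  split_ifs with h
  · obtain ⟨c, rfl⟩ := h
    rw [← mul_neg, Int.mul_ediv_cancel_left _ hn'.ne', Int.mul_ediv_cancel_left _ hn'.ne']; ring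
  · have h1 := Int.emod_add_mul_ediv z n
    have h2 := Int.emod_nonneg z hn'.ne'
    have h3 := Int.emod_lt_of_pos z hn'
    have h4 : z % n ≠ 0 := fun h' => h (Int.dvd_of_emod_eq_zero h')
    have : (-z) / (n : ℤ) = -(z / n) - 1 := by
      rw [Int.ediv_eq_iff_of_pos hn']
      constructor <;> nlinarith [lt_of_le_of_ne h2 (Ne.symm h4)]
    rw [this]; ring

lemma base_ge (n : ℕ) (hn : 0 < n) (e x1 M : ℤ) :
    M * e + 1 ≤ ∑ x ∈ Finset.range n, (1 + (x1 + x) * e / n + (M - (x1 + x)) * e / n) := by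
  classical
  rw [base n hn]
  have hn' : (0 : ℤ) < n := by exact_mod_cast hn
  have : 0 < ((Finset.range n).filter (fun x : ℕ => (n : ℤ) ∣ (x1 + x) * e)).card := by
    rw [Finset.card_pos]
    refine ⟨((-x1) % n).toNat, ?_⟩
    have h2 := Int.emod_nonneg (-x1) hn'.ne'
    have h3 := Int.emod_lt_of_pos (-x1) hn'
    rw [Finset.mem_filter, Finset.mem_range]
    refine ⟨by omega, ?_⟩
    rw [Int.toNat_of_nonneg h2]
    apply Dvd.dvd.mul_right
    have := Int.emod_add_mul_ediv (-x1) n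
    exact ⟨-(-x1 / n), by linarith⟩
  have : (1 : ℤ) ≤ ((Finset.range n).filter (fun x : ℕ => (n : ℤ) ∣ (x1 + x) * e)).card := by
    exact_mod_cast this
  linarith

lemma base_eq (n : ℕ) (hn : 0 < n) (e x1 M : ℤ) (hc : IsCoprime (n : ℤ) e) :
    ∑ x ∈ Finset.range n, (1 + (x1 + x) * e / n + (M - (x1 + x)) * e / n) = M * e + 1 := by
  classical
  apply le_antisymm _ (base_ge n hn e x1 M)
  rw [base n hn]
  have : ((Finset.range n).filter (fun x : ℕ => (n : ℤ) ∣ (x1 + x) * e)).card ≤ 1 := by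
    rw [Finset.card_le_one]
    intro p hp q hq
    rw [Finset.mem_filter, Finset.mem_range] at hp hq
    have h1 := hc.dvd_of_dvd_mul_right hp.2
    have h2 := hc.dvd_of_dvd_mul_right hq.2
    have h3 : (n : ℤ) ∣ (p : ℤ) - q := by
      have := dvd_sub h1 h2
      simpa using this
    have := Int.eq_zero_of_abs_lt_dvd h3 (by rw [abs_lt]; constructor <;> omega)
    omega
  have : (((Finset.range n).filter (fun x : ℕ => (n : ℤ) ∣ (x1 + x) * e)).card : ℤ) ≤ 1 := by
    exact_mod_cast this
  linarith

def F (h a b : ℤ) (i : ℤ) : ℤ := PS (fun i => 1 + (h + 1 + i) * a / b + (h - i) * a / b) i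

lemma F_zero (h a b : ℤ) : F h a b 0 = 0 := PS_zero _

lemma F_succ (h a b i : ℤ) :
    F h a b (i + 1) = F h a b i + (1 + (h + 1 + i) * a / b + (h - i) * a / b) := PS_succ _ _

lemma F_add (h a b i : ℤ) (n : ℕ) :
    F h a b (i + n) = F h a b i +
      ∑ x ∈ Finset.range n, (1 + (h + 1 + (i + x)) * a / b + (h - (i + x)) * a / b) := PS_add _ _ _

lemma F_lower (h a b : ℤ) (hb : 0 < b) (i : ℤ) (n : ℕ) (hn : 0 < n) (h1 : -h ≤ i) (h2 : i + n ≤ h) :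
    (2 * h + 1) * (n * a / b) < F h a b (i + n) - F h a b i := by
  rw [F_add, add_sub_cancel_left]
  set e := n * a / b with he
  have hn' : (0 : ℤ) < n := by exact_mod_cast hn
  have heb : e * b ≤ n * a := Int.ediv_mul_le _ hb.ne'
  have key : ∀ z : ℤ, 0 ≤ z → z * e / n ≤ z * a / b := by
    intro z hz
    rw [Int.le_ediv_iff_mul_le hb]
    have h3 : z * e / n * n ≤ z * e := Int.ediv_mul_le _ hn'.ne'
    have h4 : z * e / n * b * n ≤ z * a * n := by nlinarith
    exact le_of_mul_le_mul_right h4 hn'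
  have := base_ge n hn e (h + 1 + i) (2 * h + 1)
  refine lt_of_lt_of_le (lt_of_lt_of_le (lt_add_one _) this) (Finset.sum_le_sum ?_)
  intro x hx
  rw [Finset.mem_range] at hx
  have k1 := key (h + 1 + (i + x)) (by omega)
  have k2 := key (h - (i + x)) (by omega)
  have e1 : h + 1 + i + x = h + 1 + (i + (x:ℤ)) := by ring
  have e2 : 2 * h + 1 - (h + 1 + (i + (x:ℤ))) = h - (i + x) := by ring
  rw [e1, e2]; linarith

lemma F_upper (h a b : ℤ) (hb : 0 < b) (i : ℤ) (n : ℕ) (hn : 0 < n) (h1 : -h ≤ i) (h2 : i + n ≤ h) :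
    F h a b (i + n) - F h a b i < (2 * h + 1) * (n * a / b + 1) := by
  rw [F_add, add_sub_cancel_left]
  set e := n * a / b with he
  have hn' : (0 : ℤ) < n := by exact_mod_cast hn
  have heb : n * a < (e + 1) * b := Int.lt_ediv_add_one_mul_self _ hb
  have key : ∀ z : ℤ, 1 ≤ z → z * a / b ≤ - (z * (-(e + 1)) / n) - 1 := by
    intro z hz
    have h5 : z * a / b * b ≤ z * a := Int.ediv_mul_le _ hb.ne'
    have h6 : z * a / b * n < z * (e + 1) := by
      have : z * a / b * n * b < z * (e + 1) * b := by nlinarith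
      exact lt_of_mul_lt_mul_right this hb.le
    have : z * (-(e + 1)) / n ≤ - (z * a / b) - 1 := by
      have : z * (-(e + 1)) / n < - (z * a / b) := by
        rw [Int.ediv_lt_iff_lt_mul hn']; linarith
      omega
    linarith
  have := base_ge n hn (-(e + 1)) (h + 1 + i) (2 * h + 1)
  have h7 : ∑ x ∈ Finset.range n, (1 + (h + 1 + (i + x)) * a / b + (h - (i + x)) * a / b) ≤
     - ∑ x ∈ Finset.range n, (1 + (h + 1 + i + x) * (-(e + 1)) / n + (2 * h + 1 - (h + 1 + i + x)) * (-(e + 1)) / n) := by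
    rw [← Finset.sum_neg_distrib]
    apply Finset.sum_le_sum
    intro x hx
    rw [Finset.mem_range] at hx
    have k1 := key (h + 1 + (i + x)) (by omega)
    have k2 := key (h - (i + x)) (by omega)
    have e1 : h + 1 + i + x = h + 1 + (i + (x:ℤ)) := by ring
    have e2 : 2 * h + 1 - (h + 1 + (i + (x:ℤ))) = h - (i + x) := by ring
    rw [e1, e2]; linarith
  linarith

lemma F_per (h a b : ℤ) (hb : 0 < b) (hc : IsCoprime b a) (i : ℤ) :
    F h a b (i + b) = F h a b i + ((2 * h + 1) * a + 1) := by
  obtain ⟨n, rfl⟩ := Int.eq_ofNat_of_zero_le hb.le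
  rw [F_add, ← base_eq n (by omega) a (h + 1 + i) (2 * h + 1) hc]
  congr 1
  apply Finset.sum_congr rfl
  intro x _
  have e1 : h + 1 + i + x = h + 1 + (i + (x:ℤ)) := by ring
  have e2 : 2 * h + 1 - (h + 1 + (i + (x:ℤ))) = h - (i + x) := by ring
  rw [e1, e2]

lemma F_per' (h a b : ℤ) (hb : 0 < b) (hc : IsCoprime b a) (i n : ℤ) :
    F h a b (i + n * b) = F h a b i + n * ((2 * h + 1) * a + 1) := by
  induction n using Int.induction_on with
  | zero => simp
  | succ k ih =>
    have := F_per h a b hb hc (i + k * b)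
    rw [ih] at this
    rw [show i + ((k:ℤ) + 1) * b = i + k * b + b by ring, this]; ring
  | pred k ih =>
    have := F_per h a b hb hc (i + (-(k:ℤ) - 1) * b)
    rw [show i + (-(k:ℤ) - 1) * b + b = i + -k * b by ring, ih] at this
    linarith

end GP

namespace GP

structure Chain (t : ℤ) where
  b : ℤ → ℤ
  a : ℤ → ℤ
  x : ℤ → ℤ
  y : ℤ → ℤ
  hb : ∀ j, 1 ≤ b j
  hbt : ∀ j, b j ≤ t
  det : ∀ j, b j * a (j + 1) - a j * b (j + 1) = 1
  sum : ∀ j, t < b j + b (j + 1)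
  hx : ∀ j, x (j + 1) = x j + t / b (j + 1) * b (j + 1)
  hy : ∀ j, y (j + 1) = y j + t / b (j + 1) * a (j + 1)

lemma consec1 (b a b' a' n : ℤ) (hb : 0 < b) (det : b * a' - a * b' = 1)
    (hb' : 0 < b') (hn : 1 ≤ n) : b' * (n * a / b) < n * a' := by
  have h1 : n * a / b * b ≤ n * a := Int.ediv_mul_le _ hb.ne'
  have h2 : b' * (n * a / b) * b < n * a' * b := by nlinarith
  exact lt_of_mul_lt_mul_right h2 hb.le

lemma consec2 (t b a b' a' n : ℤ) (hb : 0 < b) (hb' : 0 < b') (det : b * a' - a * b' = 1)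
    (sum : t < b + b') (hn : n ≤ t) : n * a' ≤ b' * (n * a / b + 1) := by
  have h1 : n * a < (n * a / b + 1) * b := Int.lt_ediv_add_one_mul_self _ hb
  by_contra hcon
  set p := n * a / b + 1
  have hw : 1 ≤ n * a' - b' * p := by omega
  have hu : 1 ≤ p * b - n * a := by omega
  have : b * (n * a' - b' * p) + b' * (p * b - n * a) = n := by
    calc _ = n * (b * a' - a * b') := by ring
      _ = n := by rw [det, mul_one]
  nlinarith

lemma consec (t b a b' a' n : ℤ) (hb : 0 < b) (hb' : 0 < b') (det : b * a' - a * b' = 1)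
    (sum : t < b + b') (hn1 : 1 ≤ n) (hn : n ≤ t) :
    n * a / b = n * a' / b' - (if b' ∣ n then 1 else 0) := by
  have h1 := consec1 b a b' a' n hb det hb' hn1
  have h2 := consec2 t b a b' a' n hb hb' det sum hn
  set e := n * a / b
  have key : n * a' / b' = e + (if b' ∣ n then 1 else 0) := by
    rw [Int.ediv_eq_iff_of_pos hb']
    split_ifs with hd
    · obtain ⟨c, rfl⟩ := hd
      have h3 : e < c * a' := by nlinarith
      have h4 : c * a' ≤ e + 1 := by
        have : b' * (c * a') ≤ b' * (e + 1) := by linarith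
        exact le_of_mul_le_mul_left this hb'
      have h5 : c * a' = e + 1 := by omega
      have h6 : b' * c * a' = b' * (e + 1) := by rw [← h5]; ring
      constructor <;> nlinarith
    · have hne : n * a' ≠ b' * (e + 1) := by
        intro hh
        apply hd
        have hc : IsCoprime b' a' := ⟨-a, b, by linarith⟩
        exact hc.dvd_of_dvd_mul_right ⟨_, hh⟩
      have := lt_of_le_of_ne h2 hne
      constructor <;> nlinarith
  omega

lemma ediv_succ (z b : ℤ) (hb : 0 < b) : (z + 1) / b = z / b + (if b ∣ z + 1 then 1 else 0) := by
  have h1 := Int.emod_add_mul_ediv z b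
  have h2 := Int.emod_nonneg z hb.ne'
  have h3 := Int.emod_lt_of_pos z hb
  rw [Int.ediv_eq_iff_of_pos hb]
  split_ifs with hd
  · obtain ⟨c, hc⟩ := hd
    have h4 : z / b < c := by nlinarith
    have h5 : c < z / b + 2 := by nlinarith
    have h6 : c = z / b + 1 := by omega
    rw [hc, h6]
    constructor <;> nlinarith
  · have : z % b + 1 ≠ b := by
      intro hh
      exact hd ⟨z / b + 1, by linarith⟩
    have : z % b + 1 < b := by omega
    constructor <;> nlinarith

def mu (h b i : ℤ) : ℤ := (h + i) / b - (h - i) / b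

lemma mu_succ (h b i : ℤ) (hb : 0 < b) : mu h b (i + 1) = mu h b i +
    ((if b ∣ h + 1 + i then 1 else 0) + (if b ∣ h - i then 1 else 0)) := by
  unfold mu
  have h1 := ediv_succ (h + i) b hb
  have h2 := ediv_succ (h - (i + 1)) b hb
  rw [show h - (i + 1) + 1 = h - i by ring] at h2
  rw [show h + i + 1 = h + 1 + i by ring] at h1
  rw [show h + (i + 1) = h + 1 + i by ring, h1, h2]
  ring

lemma transfer_step (t h b a b' a' i : ℤ) (hb : 0 < b) (hb' : 0 < b')
    (det : b * a' - a * b' = 1) (sum : t < b + b') (ht : 2 * h ≤ t) (h1 : -h ≤ i) (h2 : i + 1 ≤ h) :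
    F h a b (i + 1) - F h a' b' (i + 1) + mu h b' (i + 1)
     = F h a b i - F h a' b' i + mu h b' i := by
  rw [F_succ, F_succ, mu_succ _ _ _ hb', consec t b a b' a' (h + 1 + i) hb hb' det sum (by omega) (by omega),
    consec t b a b' a' (h - i) hb hb' det sum (by omega) (by omega)]
  ring

lemma transfer (t h b a b' a' i : ℤ) (hb : 0 < b) (hb' : 0 < b')
    (det : b * a' - a * b' = 1) (sum : t < b + b') (ht : 2 * h ≤ t) (h1 : -h ≤ i) (h2 : i ≤ h) :
    F h a b i = F h a' b' i - mu h b' i := by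
  suffices H : ∀ n : ℕ, (n : ℤ) ≤ h → (F h a b n - F h a' b' n + mu h b' n = 0 ∧
      F h a b (-n) - F h a' b' (-n) + mu h b' (-n) = 0) by
    rcases le_total 0 i with hi | hi
    · have := (H i.toNat (by omega)).1
      rw [Int.toNat_of_nonneg hi] at this
      linarith
    · have := (H (-i).toNat (by omega)).2
      rw [Int.toNat_of_nonneg (by omega), neg_neg] at this
      linarith
  intro n
  induction n with
  | zero => intro _; simp [F_zero, mu]
  | succ n ih =>
    intro hn
    push_cast at hn
    obtain ⟨i1, i2⟩ := ih (by omega)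
    have e1 := transfer_step t h b a b' a' n hb hb' det sum ht (by omega) (by omega)
    have e2 := transfer_step t h b a b' a' (-n - 1) hb hb' det sum ht (by omega) (by omega)
    rw [show -(n : ℤ) - 1 + 1 = -n by ring] at e2
    push_cast
    rw [show -((n : ℤ) + 1) = -n - 1 by ring]
    constructor <;> linarith

section
variable {t : ℤ} (C : Chain t) (h : ℤ)

lemma Chain.cop (j : ℤ) : IsCoprime (C.b j) (C.a j) :=
  ⟨C.a (j + 1), - C.b (j + 1), by linarith [C.det j]⟩

def Chain.F (j i : ℤ) : ℤ := GP.F h (C.a j) (C.b j) i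

lemma Chain.F_lt {j i i' : ℤ} (h1 : -h ≤ i) (h2 : i < i') (h3 : i' ≤ h) :
    (2 * h + 1) * ((i' - i) * C.a j / C.b j) < C.F h j i' - C.F h j i ∧
    C.F h j i' - C.F h j i < (2 * h + 1) * ((i' - i) * C.a j / C.b j + 1) := by
  obtain ⟨n, hn⟩ := Int.eq_ofNat_of_zero_le (show 0 ≤ i' - i by omega)
  have hi : i' = i + n := by omega
  rw [hn, hi]
  have := C.hb j
  exact ⟨F_lower h _ _ (by omega) i n (by omega) h1 (by omega),
    F_upper h _ _ (by omega) i n (by omega) h1 (by omega)⟩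

lemma Chain.F_inj {j i i' : ℤ} (h1 : -h ≤ i) (h2 : i ≤ h) (h3 : -h ≤ i') (h4 : i' ≤ h)
    (hd : (2 * h + 1) ∣ C.F h j i' - C.F h j i) : i = i' := by
  have aux : ∀ i i' : ℤ, -h ≤ i → i' ≤ h → (2 * h + 1) ∣ C.F h j i' - C.F h j i → ¬ i < i' := by
    intro i i' h1 h4 ⟨c, hc⟩ hlt
    have := C.F_lt h (j := j) h1 hlt h4
    rw [hc] at this
    have hN : (0 : ℤ) < 2 * h + 1 := by omega
    have l1 := lt_of_mul_lt_mul_left this.1 hN.le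
    have l2 := lt_of_mul_lt_mul_left this.2 hN.le
    omega
  have a1 := aux i i' h1 h4 hd
  have a2 := aux i' i h3 h2 (by rw [← neg_sub]; exact (dvd_neg).2 hd)
  omega

lemma Chain.F_surj (hh : 0 ≤ h) (j m : ℤ) :
    ∃ I Z : ℤ, -h ≤ I ∧ I ≤ h ∧ (2 * h + 1) * Z = C.F h j I + m := by
  have hN : (0 : ℤ) < 2 * h + 1 := by omega
  have := Finset.surj_on_of_inj_on_of_card_le (s := Finset.Icc (-h) h) (t := Finset.Ico 0 (2 * h + 1))
    (fun i _ => (C.F h j i + m) % (2 * h + 1))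
    (fun i _ => by
      rw [Finset.mem_Ico]
      exact ⟨Int.emod_nonneg _ hN.ne', Int.emod_lt_of_pos _ hN⟩)
    (fun i i' hi hi' hee => by
      rw [Finset.mem_Icc] at hi hi'
      apply C.F_inj h hi.1 hi.2 hi'.1 hi'.2 (j := j)
      have := Int.ModEq.dvd (show C.F h j i + m ≡ C.F h j i' + m [ZMOD (2 * h + 1)] from hee)
      rwa [add_sub_add_right_eq_sub] at this)
    (by rw [Int.card_Icc, Int.card_Ico]; apply le_of_eq; congr 1; ring)
    0 (by rw [Finset.mem_Ico]; omega)
  obtain ⟨I, hI, h0⟩ := this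
  rw [Finset.mem_Icc] at hI
  obtain ⟨Z, hZ⟩ := Int.dvd_of_emod_eq_zero h0.symm
  exact ⟨I, Z, hI.1, hI.2, hZ.symm⟩

end

/-- All data for the peeling argument. -/
structure Data (t h : ℤ) where
  C : Chain t
  hh : 0 ≤ h
  h1 : 2 * h ≤ t
  h2 : t ≤ 2 * h + 1

section
variable {t h : ℤ} (D : Data t h)

lemma Data.step (j i : ℤ) (h1 : -h ≤ i) (h2 : i ≤ h) :
    ∃ l : ℤ, 0 ≤ l ∧ -h ≤ i + (l - t / D.C.b (j + 1)) * D.C.b (j + 1) ∧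
      i + (l - t / D.C.b (j + 1)) * D.C.b (j + 1) ≤ h ∧
      D.C.F h (j + 1) (i + (l - t / D.C.b (j + 1)) * D.C.b (j + 1)) =
        D.C.F h j i + (2 * h + 1) * ((l - t / D.C.b (j + 1)) * D.C.a (j + 1)) ∧
      (-h ≤ i - t / D.C.b (j + 1) * D.C.b (j + 1) → l = 0) := by
  have hb := D.C.hb j
  have hb' := D.C.hb (j + 1)
  have hD := D.h1
  have tr := transfer t h _ _ _ _ i (by omega) (by omega) (D.C.det j) (D.C.sum j) D.h1 h1 h2
  have per := fun n => F_per' h (D.C.a (j + 1)) (D.C.b (j + 1)) (by omega) (D.C.cop (j + 1)) i n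
  unfold Chain.F
  set b := D.C.b (j + 1)
  set k := t / b with hk
  have hb0 : 0 < b := by omega
  have m1 : (h + i) / b * b ≤ h + i := Int.ediv_mul_le _ hb0.ne'
  have m2 : (h - i) / b * b ≤ h - i := Int.ediv_mul_le _ hb0.ne'
  have m3 : 0 ≤ (h + i) / b := Int.ediv_nonneg (by omega) hb0.le
  have m4 : 0 ≤ (h - i) / b := Int.ediv_nonneg (by omega) hb0.le
  have m5 : (h + i) / b ≤ k := Int.ediv_le_ediv hb0 (by omega)
  have m6 : t < (k + 1) * b := Int.lt_ediv_add_one_mul_self _ hb0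
  refine ⟨k - mu h b i, ?_, ?_, ?_, ?_, ?_⟩
  · unfold mu; omega
  · unfold mu; nlinarith
  · unfold mu; nlinarith
  · rw [per, tr]; ring
  · intro hk2
    have e1 : k ≤ (h + i) / b := by rw [Int.le_ediv_iff_mul_le hb0]; linarith
    have e2 : (h - i) / b = 0 := Int.ediv_eq_zero_of_lt (by omega) (by nlinarith)
    unfold mu; omega

lemma Data.xgap (j : ℤ) : D.C.x j < D.C.x (j + 1) ∧ D.C.x (j + 1) ≤ D.C.x j + t := by
  have hb := D.C.hb (j + 1)
  have hbt := D.C.hbt (j + 1)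
  have m1 : t / D.C.b (j + 1) * D.C.b (j + 1) ≤ t := Int.ediv_mul_le _ (by omega)
  have m2 : 1 ≤ t / D.C.b (j + 1) := by rw [Int.le_ediv_iff_mul_le (by omega)]; omega
  rw [D.C.hx]
  constructor <;> nlinarith

lemma Data.xmono : StrictMono D.C.x := strictMono_int_of_lt_succ (fun j => (D.xgap j).1)

lemma Data.cons1 (j X : ℤ) (h1 : X ≤ D.C.x j + h) (h2 : D.C.x (j + 1) - h ≤ X) :
    (2 * h + 1) * D.C.y (j + 1) + D.C.F h (j + 1) (X - D.C.x (j + 1)) =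
      (2 * h + 1) * D.C.y j + D.C.F h j (X - D.C.x j) := by
  have hg := (D.xgap j).1
  obtain ⟨l, hl, _, _, hF, h0⟩ := D.step j (X - D.C.x j) (by omega) (by omega)
  have hx := D.C.hx j
  obtain rfl := h0 (by omega)
  rw [show X - D.C.x j + (0 - t / D.C.b (j + 1)) * D.C.b (j + 1) = X - D.C.x (j + 1) by rw [hx]; ring] at hF
  rw [hF, D.C.hy]; ring

lemma Data.cons (n : ℕ) (j X : ℤ) (h1 : X ≤ D.C.x j + h) (h2 : D.C.x (j + n) - h ≤ X) :
    (2 * h + 1) * D.C.y (j + n) + D.C.F h (j + n) (X - D.C.x (j + n)) =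
      (2 * h + 1) * D.C.y j + D.C.F h j (X - D.C.x j) := by
  induction n with
  | zero => simp
  | succ n ih =>
    push_cast at h2 ⊢
    rw [← add_assoc] at h2 ⊢
    have m1 : D.C.x (j + n) < D.C.x (j + n + 1) := D.xmono (by omega)
    have m2 : D.C.x j ≤ D.C.x (j + n) := D.xmono.monotone (by omega)
    rw [D.cons1 _ _ (by omega) h2, ih (by omega)]

/-- consistency of windows -/
lemma Data.cons' (i j X : ℤ) (h1 : |X - D.C.x i| ≤ h) (h2 : |X - D.C.x j| ≤ h) :
    (2 * h + 1) * D.C.y i + D.C.F h i (X - D.C.x i) =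
      (2 * h + 1) * D.C.y j + D.C.F h j (X - D.C.x j) := by
  rw [abs_le] at h1 h2
  rcases le_total i j with hij | hij
  · obtain ⟨n, hn⟩ := Int.eq_ofNat_of_zero_le (show 0 ≤ j - i by omega)
    obtain rfl : j = i + n := by omega
    exact (D.cons n i X (by omega) (by omega)).symm
  · obtain ⟨n, hn⟩ := Int.eq_ofNat_of_zero_le (show 0 ≤ i - j by omega)
    obtain rfl : i = j + n := by omega
    exact (D.cons n j X (by omega) (by omega))

noncomputable def Data.I (m j : ℤ) : ℤ := (D.C.F_surj h D.hh j m).choose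
noncomputable def Data.Z (m j : ℤ) : ℤ := (D.C.F_surj h D.hh j m).choose_spec.choose
lemma Data.IZ (m j : ℤ) : -h ≤ D.I m j ∧ D.I m j ≤ h ∧
  (2 * h + 1) * D.Z m j = D.C.F h j (D.I m j) + m := (D.C.F_surj h D.hh j m).choose_spec.choose_spec

lemma Data.IZ_unique (m j i z : ℤ) (h1 : -h ≤ i) (h2 : i ≤ h)
    (h3 : (2 * h + 1) * z = D.C.F h j i + m) : i = D.I m j ∧ z = D.Z m j := by
  obtain ⟨k1, k2, k3⟩ := D.IZ m j
  have e : i = D.I m j := D.C.F_inj h (j := j) h1 h2 k1 k2 ⟨D.Z m j - z, by linarith⟩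
  refine ⟨e, ?_⟩
  rw [← e, ← h3] at k3
  have := D.hh
  exact (mul_left_cancel₀ (by omega) k3).symm

noncomputable def Data.X (m j : ℤ) : ℤ := D.C.x j + D.I m j
noncomputable def Data.Y (m j : ℤ) : ℤ := D.C.y j + D.Z m j

lemma Data.XY_step (m j : ℤ) : ∃ l : ℤ, 0 ≤ l ∧ D.X m (j + 1) = D.X m j + l * D.C.b (j + 1) ∧
    D.Y m (j + 1) = D.Y m j + l * D.C.a (j + 1) := by
  obtain ⟨k1, k2, k3⟩ := D.IZ m j
  obtain ⟨l, hl, h1, h2, hF, _⟩ := D.step j (D.I m j) k1 k2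
  obtain ⟨e1, e2⟩ := D.IZ_unique m (j + 1) _ (D.Z m j + (l - t / D.C.b (j + 1)) * D.C.a (j + 1)) h1 h2
    (by rw [hF]; linarith)
  refine ⟨l, hl, ?_, ?_⟩
  · unfold Data.X; rw [← e1, D.C.hx]; ring
  · unfold Data.Y; rw [← e2, D.C.hy]; ring

/-- membership in the m-th level, integer version -/
def Data.U (m X Y : ℤ) : Prop :=
  ∀ j, |X - D.C.x j| ≤ h → (2 * h + 1) * D.C.y j + D.C.F h j (X - D.C.x j) + m ≤ (2 * h + 1) * Y

lemma Data.fact1 (m j X Y : ℤ) (hw : |X - D.C.x j| ≤ h)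
    (hU : (2 * h + 1) * D.C.y j + D.C.F h j (X - D.C.x j) + m ≤ (2 * h + 1) * Y) :
    (X - D.X m j) * D.C.a j ≤ (Y - D.Y m j) * D.C.b j ∧
    (X - D.X m j) * D.C.a (j + 1) ≤ (Y - D.Y m j) * D.C.b (j + 1) := by
  obtain ⟨k1, k2, k3⟩ := D.IZ m j
  have hb : 0 < D.C.b j := by linarith [D.C.hb j]
  have hb' : 0 < D.C.b (j + 1) := by linarith [D.C.hb (j + 1)]
  have hh := D.hh
  have hh1 := D.h1
  have hN : (0 : ℤ) < 2 * h + 1 := by omega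
  rw [abs_le] at hw
  have hX : X - D.X m j = (X - D.C.x j) - D.I m j := by unfold Data.X; ring
  have hY : (2 * h + 1) * (Y - D.Y m j) ≥ D.C.F h j (X - D.C.x j) - D.C.F h j (D.I m j) := by
    unfold Data.Y; linarith
  rw [hX]
  set i := X - D.C.x j
  set I := D.I m j
  set w := Y - D.Y m j
  rcases lt_trichotomy i I with hlt | heq | hgt
  · obtain ⟨l1, l2⟩ := D.C.F_lt h (j := j) hw.1 hlt k2
    have c1 := consec1 _ _ _ _ (I - i) hb (D.C.det j) hb' (by omega)
    have c2 : (I - i) * D.C.a j / D.C.b j * D.C.b j ≤ (I - i) * D.C.a j := Int.ediv_mul_le _ hb.ne'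
    set e := (I - i) * D.C.a j / D.C.b j
    have : -w < e + 1 := by
      have : (2 * h + 1) * (-w) < (2 * h + 1) * (e + 1) := by linarith
      exact lt_of_mul_lt_mul_left this hN.le
    have : -w ≤ e := by omega
    constructor <;> nlinarith
  · rw [heq] at hY ⊢
    have : 0 ≤ w := by
      have : (2 * h + 1) * 0 ≤ (2 * h + 1) * w := by linarith
      exact le_of_mul_le_mul_left this hN
    constructor <;> nlinarith
  · obtain ⟨l1, l2⟩ := D.C.F_lt h (j := j) k1 hgt hw.2
    have c1 := consec2 t _ _ _ _ (i - I) hb hb' (D.C.det j) (D.C.sum j) (by omega)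
    have c2 : (i - I) * D.C.a j < ((i - I) * D.C.a j / D.C.b j + 1) * D.C.b j := Int.lt_ediv_add_one_mul_self _ hb
    set e := (i - I) * D.C.a j / D.C.b j
    have : e < w := by
      have : (2 * h + 1) * e < (2 * h + 1) * w := by linarith
      exact lt_of_mul_lt_mul_left this hN.le
    have : e + 1 ≤ w := by omega
    constructor <;> nlinarith

lemma Data.fact2 (m j X Y : ℤ) (hU : D.U m X Y) (h1 : D.X m j ≤ X) (h2 : X ≤ D.X m (j + 1)) :
    (X - D.X m j) * D.C.a (j + 1) ≤ (Y - D.Y m j) * D.C.b (j + 1) := by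
  have hg := (D.xgap j)
  have hh2 := D.h2
  have k := D.IZ m j
  have k' := D.IZ m (j + 1)
  by_cases hw : X ≤ D.C.x j + h
  · have hw' : |X - D.C.x j| ≤ h := by
      rw [abs_le]; unfold Data.X at h1; omega
    exact (D.fact1 m j X Y hw' (hU j hw')).2
  · have hw' : |X - D.C.x (j + 1)| ≤ h := by
      rw [abs_le]; unfold Data.X at h2; omega
    have := (D.fact1 m (j + 1) X Y hw' (hU _ hw')).1
    obtain ⟨l, hl, e1, e2⟩ := D.XY_step m j
    rw [e1, e2] at this
    linarith

lemma exists_between (Z : ℤ → ℤ) (h1 : ∀ M, ∃ j0, ∀ j, j0 ≤ j → M < Z j) (h2 : ∀ M, ∃ j, Z j ≤ M) (X : ℤ) :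
    ∃ j, Z j ≤ X ∧ X < Z (j + 1) := by
  obtain ⟨j0, hj0⟩ := h1 X
  obtain ⟨j, hj, hmax⟩ := Int.exists_greatest_of_bdd (P := fun j => Z j ≤ X)
    ⟨j0, fun z hz => by by_contra hc; have := hj0 z (by omega); omega⟩ (h2 X)
  refine ⟨j, hj, ?_⟩
  by_contra hc
  have := hmax (j + 1) (by omega)
  omega

lemma Data.x_ge (j : ℤ) (hj : 0 ≤ j) : D.C.x 0 + j ≤ D.C.x j := by
  obtain ⟨n, rfl⟩ := Int.eq_ofNat_of_zero_le hj
  clear hj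
  induction n with
  | zero => simp
  | succ n ih => have := (D.xgap n).1; push_cast; omega

lemma Data.x_le (n : ℕ) : D.C.x (-n) ≤ D.C.x 0 - n := by
  induction n with
  | zero => simp
  | succ n ih =>
    have := (D.xgap (-(n+1))).1
    rw [show -((n:ℤ)+1) + 1 = -n by ring] at this
    push_cast; push_cast at this; omega

lemma Data.X_top (m M : ℤ) : ∃ j0, ∀ j, j0 ≤ j → M < D.X m j := by
  refine ⟨|M - D.C.x 0 + h| + 1, fun j hj => ?_⟩
  have := abs_nonneg (M - D.C.x 0 + h)
  have := le_abs_self (M - D.C.x 0 + h)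
  have := D.x_ge j (by omega)
  have := D.IZ m j
  unfold Data.X; omega

lemma Data.X_bot (m M : ℤ) : ∃ j, D.X m j ≤ M := by
  refine ⟨-((|D.C.x 0 + h - M|).toNat : ℤ), ?_⟩
  have := abs_nonneg (D.C.x 0 + h - M)
  have := le_abs_self (D.C.x 0 + h - M)
  have := D.x_le (|D.C.x 0 + h - M|).toNat
  have := D.IZ m (-((|D.C.x 0 + h - M|).toNat : ℤ))
  unfold Data.X; omega

lemma Data.cover (X : ℤ) : ∃ j, |X - D.C.x j| ≤ h := by
  have hh := D.hh
  obtain ⟨j, h1, h2⟩ := exists_between D.C.x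
    (fun M => by
      obtain ⟨j0, hj⟩ := D.X_top 0 (M + h)
      refine ⟨j0, fun j hj' => ?_⟩
      have := hj j hj'
      have := D.IZ 0 j
      unfold Data.X at *; omega)
    (fun M => by
      obtain ⟨j, hj⟩ := D.X_bot 0 (M - h)
      refine ⟨j, ?_⟩
      have := D.IZ 0 j
      unfold Data.X at *; omega) X
  have := D.xgap j
  have := D.h2
  by_cases hX : X - D.C.x j ≤ h
  · exact ⟨j, by rw [abs_le]; omega⟩
  · exact ⟨j + 1, by rw [abs_le]; omega⟩

lemma Data.q_mem (m j : ℤ) : D.U m (D.X m j) (D.Y m j) := by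
  intro i hi
  obtain ⟨k1, k2, k3⟩ := D.IZ m j
  have := D.cons' i j (D.X m j) hi (by rw [abs_le]; unfold Data.X; omega)
  rw [this]
  have : D.X m j - D.C.x j = D.I m j := by unfold Data.X; ring
  rw [this]; unfold Data.Y; linarith

lemma Data.U_succ (m X Y : ℤ) : D.U (m + 1) X Y ↔ D.U m X Y ∧ ¬ ∃ j, X = D.X m j ∧ Y = D.Y m j := by
  constructor
  · intro hU
    refine ⟨fun j hj => by linarith [hU j hj], ?_⟩
    rintro ⟨j, rfl, rfl⟩
    obtain ⟨k1, k2, k3⟩ := D.IZ m j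
    have := hU j (by rw [abs_le]; unfold Data.X; omega)
    rw [show D.X m j - D.C.x j = D.I m j by unfold Data.X; ring] at this
    unfold Data.Y at this; linarith
  · rintro ⟨hU, hn⟩ j hj
    have := hU j hj
    rcases this.eq_or_lt with he | hl
    · exfalso
      apply hn
      rw [abs_le] at hj
      obtain ⟨e1, e2⟩ := D.IZ_unique m j (X - D.C.x j) (Y - D.C.y j) hj.1 hj.2 (by linarith)
      exact ⟨j, by unfold Data.X; omega, by unfold Data.Y; omega⟩
    · omega

end
end GP

namespace GP

lemma support (X Y sl : ℤ → ℝ) (U : Set (ℝ × ℝ)) (hsl : StrictMono sl) (hX : ∀ i, X i ≤ X (i + 1))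
    (hY : ∀ i, Y (i + 1) = Y i + sl (i + 1) * (X (i + 1) - X i))
    (hcov : ∀ r ∈ U, ∃ i, X i ≤ r.1 ∧ r.1 ≤ X (i + 1) ∧ Y i + sl (i + 1) * (r.1 - X i) ≤ r.2)
    (j : ℤ) (s : ℝ) (h1 : sl j ≤ s) (h2 : s ≤ sl (j + 1)) (r : ℝ × ℝ) (hr : r ∈ U) :
    Y j + s * (r.1 - X j) ≤ r.2 := by
  have right : ∀ n : ℕ, Y j + s * (X (j + n) - X j) ≤ Y (j + n) := by
    intro n
    induction n with
    | zero => simp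
    | succ n ih =>
      push_cast
      rw [← add_assoc]
      have := hX (j + n)
      have := hY (j + n)
      have := hsl.monotone (show j + 1 ≤ j + n + 1 by omega)
      nlinarith
  have left : ∀ n : ℕ, Y j + s * (X (j - n) - X j) ≤ Y (j - n) := by
    intro n
    induction n with
    | zero => simp
    | succ n ih =>
      push_cast
      have e1 := hX (j - n - 1)
      have e2 := hY (j - n - 1)
      have := hsl.monotone (show j - n ≤ j by omega)
      rw [show j - (n : ℤ) - 1 + 1 = j - n by ring] at e1 e2
      rw [show j - ((n : ℤ) + 1) = j - n - 1 by ring]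
      nlinarith
  obtain ⟨i, g1, g2, g3⟩ := hcov r hr
  rcases le_or_gt j i with hij | hij
  · obtain ⟨n, hn⟩ := Int.eq_ofNat_of_zero_le (show 0 ≤ i - j by omega)
    obtain rfl : i = j + n := by omega
    have := right n
    have := hsl.monotone (show j + 1 ≤ j + n + 1 by omega)
    nlinarith
  · obtain ⟨n, hn⟩ := Int.eq_ofNat_of_zero_le (show 0 ≤ j - (i + 1) by omega)
    obtain rfl : i = j - n - 1 := by omega
    have e0 := left n
    have e2 := hY (j - n - 1)
    rw [show j - (n : ℤ) - 1 + 1 = j - n by ring] at e2 g2 g3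
    have := hsl.monotone (show j - n ≤ j by omega)
    nlinarith

lemma hull_ge (U : Set (ℝ × ℝ)) (c s x0 : ℝ) (h : ∀ r ∈ U, c + s * (r.1 - x0) ≤ r.2) :
    ∀ r ∈ convexHull ℝ U, c + s * (r.1 - x0) ≤ r.2 := by
  have hc : Convex ℝ {r : ℝ × ℝ | c + s * (r.1 - x0) ≤ r.2} := by
    intro p hp q hq u v hu hv huv
    simp only [Set.mem_ofPred_eq, Prod.fst_add, Prod.snd_add, Prod.smul_fst, Prod.smul_snd, smul_eq_mul] at *
    have : v = 1 - u := by linarith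
    subst this
    nlinarith
  intro r hr
  exact convexHull_min (fun r hr => h r hr) hc hr

lemma extreme_eq (X Y sl : ℤ → ℝ) (U : Set (ℝ × ℝ)) (hsl : StrictMono sl) (hX : ∀ i, X i ≤ X (i + 1))
    (hY : ∀ i, Y (i + 1) = Y i + sl (i + 1) * (X (i + 1) - X i))
    (hcov : ∀ r ∈ U, ∃ i, X i ≤ r.1 ∧ r.1 ≤ X (i + 1) ∧ Y i + sl (i + 1) * (r.1 - X i) ≤ r.2)
    (hq : ∀ i, (X i, Y i) ∈ U) (hup : ∀ r ∈ U, (r.1, r.2 + 1) ∈ U) :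
    Set.extremePoints ℝ (convexHull ℝ U) = Set.range (fun i => (X i, Y i)) := by
  ext p
  constructor
  · intro hp
    have hpU : p ∈ U := extremePoints_convexHull_subset hp
    rw [mem_extremePoints_iff_forall_segment] at hp
    obtain ⟨_, hp⟩ := hp
    obtain ⟨i, g1, g2, g3⟩ := hcov p hpU
    have hqi := subset_convexHull ℝ U (hq i)
    have hqi' := subset_convexHull ℝ U (hq (i + 1))
    have hE : (p.1, Y i + sl (i + 1) * (p.1 - X i)) ∈ segment ℝ (X i, Y i) (X (i + 1), Y (i + 1)) := by
      rw [segment_eq_image_lineMap]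
      rcases (hX i).eq_or_lt with he | hl
      · refine ⟨0, by simp, ?_⟩
        have : p.1 = X i := by linarith
        simp [this]
      · refine ⟨(p.1 - X i) / (X (i + 1) - X i), ⟨?_, ?_⟩, ?_⟩
        · apply div_nonneg <;> linarith
        · rw [div_le_one] <;> linarith
        · have : X (i + 1) - X i ≠ 0 := by linarith
          rw [AffineMap.lineMap_apply]
          ext
          · simp; field_simp; ring
          · simp [hY]; field_simp; ring
    have hEh := (convex_convexHull ℝ U).segment_subset hqi hqi' hE
    have hseg : p ∈ segment ℝ (p.1, Y i + sl (i + 1) * (p.1 - X i)) (p.1, p.2 + 1) := by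
      rw [segment_eq_image_lineMap]
      set E := Y i + sl (i + 1) * (p.1 - X i)
      refine ⟨(p.2 - E) / (p.2 + 1 - E), ⟨?_, ?_⟩, ?_⟩
      · apply div_nonneg <;> linarith
      · rw [div_le_one] <;> linarith
      · have : p.2 + 1 - E ≠ 0 := by linarith
        rw [AffineMap.lineMap_apply]
        ext
        · simp
        · simp; field_simp; ring
    rcases hp _ hEh _ (subset_convexHull ℝ U (hup p hpU)) hseg with h1 | h1
    · rw [h1] at hE
      rcases hp _ hqi _ hqi' hE with h2 | h2
      · exact ⟨i, h2⟩
      · exact ⟨i + 1, h2⟩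
    · have := congrArg Prod.snd h1
      simp at this
  · rintro ⟨j, rfl⟩
    have hlt := hsl (show j < j + 1 by omega)
    have s1 := hull_ge U _ _ _ (support X Y sl U hsl hX hY hcov j (sl j) le_rfl hlt.le)
    have s2 := hull_ge U _ _ _ (support X Y sl U hsl hX hY hcov j (sl (j + 1)) hlt.le le_rfl)
    rw [mem_extremePoints]
    refine ⟨subset_convexHull ℝ U (hq j), ?_⟩
    have aux : ∀ p ∈ convexHull ℝ U, ∀ q ∈ convexHull ℝ U, (X j, Y j) ∈ openSegment ℝ p q → p = (X j, Y j) := by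
      rintro p hp q hq ⟨u, v, hu, hv, huv, he⟩
      have e1 := congrArg Prod.fst he
      have e2 := congrArg Prod.snd he
      simp only [Prod.fst_add, Prod.snd_add, Prod.smul_fst, Prod.smul_snd, smul_eq_mul] at e1 e2
      have key : ∀ s : ℝ, Y j + s * (p.1 - X j) ≤ p.2 → Y j + s * (q.1 - X j) ≤ q.2 →
          p.2 = Y j + s * (p.1 - X j) := by
        intro s k1 k2
        by_contra hne
        have k3 : Y j + s * (p.1 - X j) < p.2 := lt_of_le_of_ne k1 (Ne.symm hne)
        have k4 : u * (p.2 - (Y j + s * (p.1 - X j))) + v * (q.2 - (Y j + s * (q.1 - X j))) = 0 := by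
          have hv' : v = 1 - u := by linarith
          subst hv'
          linear_combination e2 - s * e1
        have k5 : 0 < u * (p.2 - (Y j + s * (p.1 - X j))) := mul_pos hu (by linarith)
        have k6 : 0 ≤ v * (q.2 - (Y j + s * (q.1 - X j))) := mul_nonneg hv.le (by linarith)
        linarith
      have a1 := key _ (s1 p hp) (s1 q hq)
      have a2 := key _ (s2 p hp) (s2 q hq)
      have a3 : (sl (j + 1) - sl j) * (p.1 - X j) = 0 := by linarith
      have a4 : p.1 = X j := by
        rcases mul_eq_zero.1 a3 with h | h <;> linarith
      rw [a4] at a1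
      ext
      · exact a4
      · simpa using a1
    intro p hp q hq hs
    exact ⟨aux p hp q hq hs, aux q hq p hp (by rw [openSegment_symm]; exact hs)⟩

variable {t h : ℤ} (D : Data t h)

def Data.US (m : ℤ) : Set (ℝ × ℝ) := {p | ∃ X Y : ℤ, p = ((X : ℝ), (Y : ℝ)) ∧ D.U m X Y}

lemma Data.mono_slope : StrictMono (fun j => (D.C.a j : ℝ) / D.C.b j) := by
  apply strictMono_int_of_lt_succ
  intro j
  have h1 : (0 : ℝ) < D.C.b j := by exact_mod_cast (show 0 < D.C.b j by linarith [D.C.hb j])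
  have h2 : (0 : ℝ) < D.C.b (j + 1) := by exact_mod_cast (show 0 < D.C.b (j + 1) by linarith [D.C.hb (j + 1)])
  have h3 : (D.C.b j * D.C.a (j + 1) - D.C.a j * D.C.b (j + 1) : ℝ) = 1 := by exact_mod_cast D.C.det j
  rw [div_lt_div_iff₀ h1 h2]
  linarith

lemma Data.extreme (m : ℤ) : Set.extremePoints ℝ (convexHull ℝ (D.US m)) =
    Set.range (fun i => ((D.X m i : ℝ), (D.Y m i : ℝ))) := by
  have hb : ∀ j, (0 : ℝ) < D.C.b j := fun j => by exact_mod_cast (show 0 < D.C.b j by linarith [D.C.hb j])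
  apply extreme_eq (fun i => (D.X m i : ℝ)) (fun i => (D.Y m i : ℝ)) (fun j => (D.C.a j : ℝ) / D.C.b j) (D.US m)
    D.mono_slope
  · intro i
    obtain ⟨l, hl, e1, e2⟩ := D.XY_step m i
    have := D.C.hb (i + 1)
    have : D.X m i ≤ D.X m (i + 1) := by rw [e1]; nlinarith
    exact_mod_cast this
  · intro i
    obtain ⟨l, hl, e1, e2⟩ := D.XY_step m i
    have := (hb (i + 1)).ne'
    rw [e1, e2]; push_cast; field_simp; ring
  · rintro r ⟨X, Y, rfl, hU⟩
    obtain ⟨j, h1, h2⟩ := exists_between (D.X m) (D.X_top m) (D.X_bot m) X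
    refine ⟨j, Int.cast_le.2 h1, Int.cast_le.2 h2.le, ?_⟩
    have := D.fact2 m j X Y hU h1 h2.le
    have h3 : ((X : ℝ) - D.X m j) * D.C.a (j + 1) ≤ (Y - D.Y m j) * D.C.b (j + 1) := by exact_mod_cast this
    simp only
    have := hb (j + 1)
    have : (D.C.a (j + 1) : ℝ) / D.C.b (j + 1) * (X - D.X m j) ≤ Y - D.Y m j := by
      rw [div_mul_eq_mul_div, div_le_iff₀ this]; linarith
    linarith
  · intro i
    exact ⟨_, _, rfl, D.q_mem m i⟩
  · rintro r ⟨X, Y, rfl, hU⟩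
    refine ⟨X, Y + 1, by push_cast; rfl, fun j hj => ?_⟩
    have := hU j hj
    have := D.hh
    linarith

lemma Data.diff (m : ℤ) : D.US m \ Set.extremePoints ℝ (convexHull ℝ (D.US m)) = D.US (m + 1) := by
  rw [D.extreme]
  ext p
  constructor
  · rintro ⟨⟨X, Y, rfl, hU⟩, hn⟩
    refine ⟨X, Y, rfl, (D.U_succ m X Y).2 ⟨hU, ?_⟩⟩
    rintro ⟨j, rfl, rfl⟩
    exact hn ⟨j, rfl⟩
  · rintro ⟨X, Y, rfl, hU⟩
    obtain ⟨hU, hn⟩ := (D.U_succ m X Y).1 hU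
    refine ⟨⟨X, Y, rfl, hU⟩, ?_⟩
    rintro ⟨j, hj⟩
    apply hn
    simp only [Prod.mk.injEq, Int.cast_inj] at hj
    exact ⟨j, hj.1.symm, hj.2.symm⟩

/-- item 7 -/
lemma Data.U_zero_iff (j X Y : ℤ) (h1 : D.C.x j ≤ X) (h2 : X ≤ D.C.x (j + 1)) :
    D.U 0 X Y ↔ (X - D.C.x j) * D.C.a (j + 1) ≤ (Y - D.C.y j) * D.C.b (j + 1) := by
  have hh := D.hh
  have hI : ∀ j, D.X 0 j = D.C.x j ∧ D.Y 0 j = D.C.y j := by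
    intro j
    obtain ⟨e1, e2⟩ := D.IZ_unique 0 j 0 0 (by omega) (by omega) (by simp [Chain.F, F_zero])
    unfold Data.X Data.Y
    rw [← e1, ← e2]; simp
  constructor
  · intro hU
    have := D.fact2 0 j X Y hU (by rw [(hI j).1]; exact h1) (by rw [(hI _).1]; exact h2)
    rwa [(hI j).1, (hI j).2] at this
  · intro hg
    have hgap := D.xgap j
    have hb : 0 < D.C.b j := by linarith [D.C.hb j]
    have hb' : 0 < D.C.b (j + 1) := by linarith [D.C.hb (j + 1)]
    have hN : (0 : ℤ) < 2 * h + 1 := by omega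
    have hF0 : ∀ j, D.C.F h j 0 = 0 := fun j => F_zero _ _ _
    have hh2 := D.h2
    suffices H : ∃ j, |X - D.C.x j| ≤ h ∧ (2 * h + 1) * D.C.y j + D.C.F h j (X - D.C.x j) + 0 ≤ (2 * h + 1) * Y by
      obtain ⟨j, hj, hj2⟩ := H
      intro i hi
      rw [D.cons' i j X hi hj]; exact hj2
    by_cases hX : X ≤ D.C.x j + h
    · refine ⟨j, by rw [abs_le]; omega, ?_⟩
      rcases h1.eq_or_lt with he | hl
      · rw [← he] at hg ⊢
        simp only [sub_self, zero_mul, hF0] at hg ⊢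
        have : 0 ≤ Y - D.C.y j := nonneg_of_mul_nonneg_left hg hb'
        nlinarith
      · have l2 := (D.C.F_lt h (j := j) (i := 0) (i' := X - D.C.x j) (by omega) (by omega) (by omega)).2
        have c1 := consec1 _ _ _ _ (X - D.C.x j) hb (D.C.det j) hb' (by omega)
        rw [hF0, sub_zero, sub_zero] at l2
        set e := (X - D.C.x j) * D.C.a j / D.C.b j
        have : e < Y - D.C.y j := by
          have : e * D.C.b (j + 1) < (Y - D.C.y j) * D.C.b (j + 1) := by linarith
          exact lt_of_mul_lt_mul_right this hb'.le
        have : e + 1 ≤ Y - D.C.y j := by omega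
        nlinarith
    · refine ⟨j + 1, by rw [abs_le]; omega, ?_⟩
      have hg' : (D.C.y (j + 1) - Y) * D.C.b (j + 1) ≤ (D.C.x (j + 1) - X) * D.C.a (j + 1) := by
        rw [D.C.hx, D.C.hy]; linarith
      rcases h2.eq_or_lt with he | hl
      · rw [he] at hg' ⊢
        simp only [sub_self, zero_mul, hF0] at hg' ⊢
        have : 0 ≤ Y - D.C.y (j + 1) := by
          by_contra hc
          nlinarith
        nlinarith
      · have l2 := (D.C.F_lt h (j := j + 1) (i := X - D.C.x (j + 1)) (i' := 0) (by omega) (by omega) (by omega)).1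
        have : D.C.y (j + 1) - Y ≤ (D.C.x (j + 1) - X) * D.C.a (j + 1) / D.C.b (j + 1) := by
          rw [Int.le_ediv_iff_mul_le hb']; exact hg'
        rw [hF0, zero_sub, zero_sub, neg_sub] at l2
        nlinarith

lemma Data.U_N (X Y : ℤ) : D.U (2 * h + 1) X Y ↔ D.U 0 X (Y - 1) := by
  unfold Data.U
  refine forall_congr' fun j => forall_congr' fun _ => ?_
  constructor <;> intro <;> linarith

end GP

namespace GP

def S (t : ℤ) : ℕ → (ℤ × ℤ) × (ℤ × ℤ)
  | 0 => ((1, 0), (t, 1))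
  | n + 1 => ((S t n).2, ((t + (S t n).1.1) / (S t n).2.1 * (S t n).2.1 - (S t n).1.1,
      (t + (S t n).1.1) / (S t n).2.1 * (S t n).2.2 - (S t n).1.2))

def bN (t : ℤ) (n : ℕ) : ℤ := (S t n).1.1
def aN (t : ℤ) (n : ℕ) : ℤ := (S t n).1.2

lemma bN_succ (t : ℤ) (n : ℕ) : bN t (n + 1) = (S t n).2.1 := rfl
lemma aN_succ (t : ℤ) (n : ℕ) : aN t (n + 1) = (S t n).2.2 := rfl

lemma S_inv (t : ℤ) (ht : 1 ≤ t) (n : ℕ) : 1 ≤ bN t n ∧ bN t n ≤ t ∧ 1 ≤ bN t (n + 1) ∧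
    bN t (n + 1) ≤ t ∧ 0 ≤ aN t n ∧ 0 ≤ aN t (n + 1) ∧
    bN t n * aN t (n + 1) - aN t n * bN t (n + 1) = 1 ∧ t < bN t n + bN t (n + 1) := by
  induction n with
  | zero => simp [bN, aN, S]; omega
  | succ n ih =>
    have e1 : bN t (n + 1 + 1) = (t + bN t n) / bN t (n + 1) * bN t (n + 1) - bN t n := rfl
    have e2 : aN t (n + 1 + 1) = (t + bN t n) / bN t (n + 1) * aN t (n + 1) - aN t n := rfl
    obtain ⟨i1, i2, i3, i4, i5, i6, i7, i8⟩ := ih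
    have hb' : 0 < bN t (n + 1) := by omega
    have c1 : (t + bN t n) / bN t (n + 1) * bN t (n + 1) ≤ t + bN t n := Int.ediv_mul_le _ hb'.ne'
    have c2 : t + bN t n < ((t + bN t n) / bN t (n + 1) + 1) * bN t (n + 1) := Int.lt_ediv_add_one_mul_self _ hb'
    set c := (t + bN t n) / bN t (n + 1)
    have f1 : t < bN t (n + 1) + bN t (n + 1 + 1) := by rw [e1]; linarith
    have f2 : bN t (n + 1) * aN t (n + 1 + 1) - aN t (n + 1) * bN t (n + 1 + 1) = 1 := by
      rw [e1, e2]; linarith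
    have f3 : 1 ≤ bN t (n + 1 + 1) := by omega
    refine ⟨i3, i4, f3, by rw [e1]; linarith, i6, ?_, f2, f1⟩
    by_contra hc
    have : 0 ≤ aN t (n + 1) * bN t (n + 1 + 1) := mul_nonneg i6 (by omega)
    nlinarith

def xN (t : ℤ) : ℕ → ℤ
  | 0 => t
  | n + 1 => xN t n + t / bN t (n + 1) * bN t (n + 1)
def yN (t : ℤ) : ℕ → ℤ
  | 0 => 0
  | n + 1 => yN t n + t / bN t (n + 1) * aN t (n + 1)

def bZ (t : ℤ) : ℤ → ℤ
  | .ofNat n => bN t n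
  | .negSucc n => bN t (n + 1)
def aZ (t : ℤ) : ℤ → ℤ
  | .ofNat n => aN t n
  | .negSucc n => -aN t (n + 1)
def xZ (t : ℤ) : ℤ → ℤ
  | .ofNat n => xN t n
  | .negSucc n => t - xN t n
def yZ (t : ℤ) : ℤ → ℤ
  | .ofNat n => yN t n
  | .negSucc n => yN t n

lemma ns0 : Int.negSucc 0 + 1 = Int.ofNat 0 := rfl
lemma ns1 (n : ℕ) : Int.negSucc (n + 1) + 1 = Int.negSucc n := by omega
lemma os (n : ℕ) : Int.ofNat n + 1 = Int.ofNat (n + 1) := rfl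

def chain (t : ℤ) (ht : 1 ≤ t) : Chain t where
  b := bZ t
  a := aZ t
  x := xZ t
  y := yZ t
  hb := by
    rintro (n | n)
    · exact (S_inv t ht n).1
    · exact (S_inv t ht n).2.2.1
  hbt := by
    rintro (n | n)
    · exact (S_inv t ht n).2.1
    · exact (S_inv t ht n).2.2.2.1
  det := by
    rintro (n | _ | n)
    · exact (S_inv t ht n).2.2.2.2.2.2.1
    · simp [bZ, aZ, bN, aN, S]
    · rw [ns1]
      have := (S_inv t ht (n + 1)).2.2.2.2.2.2.1
      simp only [bZ, aZ]
      linarith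
  sum := by
    rintro (n | _ | n)
    · exact (S_inv t ht n).2.2.2.2.2.2.2
    · simp [bZ, bN, S]
    · rw [ns1]
      have := (S_inv t ht (n + 1)).2.2.2.2.2.2.2
      simp only [bZ]
      linarith
  hx := by
    rintro (n | _ | n)
    · rfl
    · simp [bZ, xZ, bN, xN, S]
    · rw [ns1]
      simp only [bZ, xZ, xN]
      ring
  hy := by
    rintro (n | _ | n)
    · rfl
    · simp [bZ, aZ, yZ, bN, aN, yN, S]
    · rw [ns1]
      simp only [bZ, aZ, yZ, yN]
      ring

def B (t n : ℕ) : ℕ := (bN t n).toNat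
def A (t n : ℕ) : ℕ := (aN t n).toNat

lemma B_cast (t : ℕ) (ht : 1 ≤ t) (n : ℕ) : (B t n : ℤ) = bN t n := by
  have := S_inv t (by exact_mod_cast ht) n
  unfold B; omega
lemma A_cast (t : ℕ) (ht : 1 ≤ t) (n : ℕ) : (A t n : ℤ) = aN t n := by
  have := S_inv t (by exact_mod_cast ht) n
  unfold A; omega

lemma AB_inv (t : ℕ) (ht : 1 ≤ t) (n : ℕ) : 1 ≤ B t n ∧ B t n ≤ t ∧
   B t n * A t (n + 1) = A t n * B t (n + 1) + 1 ∧ t < B t n + B t (n + 1) := by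
  have := S_inv t (by exact_mod_cast ht) n
  rw [← B_cast t ht, ← A_cast t ht, ← B_cast t ht, ← A_cast t ht] at this
  obtain ⟨i1, i2, i3, i4, i5, i6, i7, i8⟩ := this
  refine ⟨by omega, by omega, ?_, by omega⟩
  zify; linarith

lemma A_pos (t : ℕ) (ht : 1 ≤ t) (n : ℕ) : 1 ≤ A t (n + 1) := by
  obtain ⟨h1, h2, h3, h4⟩ := AB_inv t ht n
  by_contra hc
  have : A t (n + 1) = 0 := by omega
  rw [this] at h3; omega

lemma AB_cop (t : ℕ) (ht : 1 ≤ t) (n : ℕ) : Nat.gcd (A t n) (B t n) = 1 := by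
  obtain ⟨h1, h2, h3, h4⟩ := AB_inv t ht n
  have d1 : Nat.gcd (A t n) (B t n) ∣ A t n * B t (n + 1) + 1 := by
    rw [← h3]; exact (Nat.gcd_dvd_right _ _).mul_right _
  have d2 : Nat.gcd (A t n) (B t n) ∣ A t n * B t (n + 1) := (Nat.gcd_dvd_left _ _).mul_right _
  exact Nat.dvd_one.1 ((Nat.dvd_add_right d2).1 d1)

lemma trich (t : ℕ) (ht : 1 ≤ t) (n a b : ℕ) (hbt : b ≤ t) (h : A t n * b < B t n * a) :
    A t (n + 1) * b ≤ B t (n + 1) * a := by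
  obtain ⟨h1, h2, h3, h4⟩ := AB_inv t ht n
  by_contra hc
  push Not at hc
  have h5 := (AB_inv t ht (n + 1)).1
  zify at *
  have hu : (1 : ℤ) ≤ B t n * a - A t n * b := by linarith
  have hw : (1 : ℤ) ≤ A t (n + 1) * b - B t (n + 1) * a := by linarith
  have : (B t (n + 1) : ℤ) * (B t n * a - A t n * b) + B t n * (A t (n + 1) * b - B t (n + 1) * a) = b := by
    calc _ = (b : ℤ) * (B t n * A t (n + 1) - A t n * B t (n + 1)) := by ring
      _ = b := by rw [h3]; ring
  nlinarith

lemma slope_eq (a b a' b' : ℕ) (h : Nat.gcd a b = 1) (h' : Nat.gcd a' b' = 1) (he : a * b' = a' * b) :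
    a = a' ∧ b = b' := by
  have c : Nat.Coprime a b := h
  have c' : Nat.Coprime a' b' := h'
  constructor
  · apply Nat.dvd_antisymm
    · exact c.dvd_of_dvd_mul_right ⟨b', he.symm⟩
    · exact c'.dvd_of_dvd_mul_right ⟨b, he⟩
  · apply Nat.dvd_antisymm
    · exact c.symm.dvd_of_dvd_mul_left ⟨a', by rw [he]; ring⟩
    · exact c'.symm.dvd_of_dvd_mul_left ⟨a, by rw [← he]; ring⟩

lemma mem_E (t a b : ℕ) (hb : 1 ≤ b) (q : ℕ × ℕ) :
    q ∈ (Finset.Icc 1 t ×ˢ Finset.Icc 1 (a * t)).filter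
      (fun q => Nat.gcd q.2 q.1 = 1 ∧ q.2 * b < a * q.1) ↔
    (1 ≤ q.1 ∧ q.1 ≤ t ∧ 1 ≤ q.2 ∧ Nat.gcd q.2 q.1 = 1 ∧ q.2 * b < a * q.1) := by
  rw [Finset.mem_filter, Finset.mem_product, Finset.mem_Icc, Finset.mem_Icc]
  constructor
  · rintro ⟨⟨⟨h1, h2⟩, h3, h4⟩, h5, h6⟩
    exact ⟨h1, h2, h3, h5, h6⟩
  · rintro ⟨h1, h2, h3, h5, h6⟩
    refine ⟨⟨⟨h1, h2⟩, h3, ?_⟩, h5, h6⟩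
    calc q.2 ≤ q.2 * b := Nat.le_mul_of_pos_right _ hb
      _ ≤ a * q.1 := h6.le
      _ ≤ a * t := Nat.mul_le_mul_left _ h2

lemma leftEnd_mono (t a b a' b' : ℕ) (hb : 1 ≤ b) (hb' : 1 ≤ b') (h : a' * b ≤ a * b') :
    leftEnd t a' b' ≤ leftEnd t a b := by
  unfold leftEnd
  apply add_le_add le_rfl
  apply Finset.sum_le_sum_of_subset_of_nonneg
  · intro q hq
    rw [mem_E _ _ _ hb'] at hq
    rw [mem_E _ _ _ hb]
    obtain ⟨h1, h2, h3, h5, h6⟩ := hq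
    refine ⟨h1, h2, h3, h5, ?_⟩
    have : q.2 * b * b' < a * q.1 * b' := by nlinarith
    exact lt_of_mul_lt_mul_right this (by omega)
  · intros; positivity

lemma leftEnd_succ (t : ℕ) (ht : 1 ≤ t) (n : ℕ) : leftEnd t (A t (n + 2)) (B t (n + 2)) =
    leftEnd t (A t (n + 1)) (B t (n + 1)) + edgeLen t (B t (n + 1)) := by
  obtain ⟨h1, h2, h3, h4⟩ := AB_inv t ht (n + 1)
  have h5 := (AB_inv t ht (n + 2)).1
  have hcop := AB_cop t ht (n + 1)
  have hA := A_pos t ht n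
  unfold leftEnd
  have : (Finset.Icc 1 t ×ˢ Finset.Icc 1 (A t (n + 2) * t)).filter
      (fun q => Nat.gcd q.2 q.1 = 1 ∧ q.2 * B t (n + 2) < A t (n + 2) * q.1) =
      insert (B t (n + 1), A t (n + 1)) ((Finset.Icc 1 t ×ˢ Finset.Icc 1 (A t (n + 1) * t)).filter
      (fun q => Nat.gcd q.2 q.1 = 1 ∧ q.2 * B t (n + 1) < A t (n + 1) * q.1)) := by
    ext q
    rw [Finset.mem_insert, mem_E _ _ _ h5, mem_E _ _ _ h1]
    constructor
    · rintro ⟨k1, k2, k3, k5, k6⟩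
      rcases lt_trichotomy (q.2 * B t (n + 1)) (A t (n + 1) * q.1) with hl | he | hg
      · right; exact ⟨k1, k2, k3, k5, hl⟩
      · left
        obtain ⟨e1, e2⟩ := slope_eq _ _ _ _ k5 hcop he
        exact Prod.ext e2 e1
      · exfalso
        have := trich t ht (n + 1) q.2 q.1 k2 (by linarith)
        rw [show n + 1 + 1 = n + 2 from rfl] at this
        linarith
    · rintro (rfl | ⟨k1, k2, k3, k5, k6⟩)
      · refine ⟨h1, h2, hA, hcop, ?_⟩
        simp only
        rw [show n + 1 + 1 = n + 2 from rfl] at h3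
        linarith
      · refine ⟨k1, k2, k3, k5, ?_⟩
        rw [show n + 1 + 1 = n + 2 from rfl] at h3
        have : q.2 * B t (n + 2) * B t (n + 1) < A t (n + 2) * q.1 * B t (n + 1) := by nlinarith
        exact lt_of_mul_lt_mul_right this (by omega)
  rw [this, Finset.sum_insert]
  · ring
  · rw [mem_E _ _ _ h1]
    simp

lemma edge_cast (t : ℕ) (ht : 1 ≤ t) (n : ℕ) :
    ((t / bN t n * bN t n : ℤ) : ℝ) = edgeLen t (B t n) := by
  rw [← B_cast t ht]
  unfold edgeLen
  push_cast
  rw [mul_comm]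
  norm_cast

lemma leftEnd_eq (t : ℕ) (ht : 1 ≤ t) (n : ℕ) :
    leftEnd t (A t (n + 1)) (B t (n + 1)) = (xN t n : ℝ) := by
  induction n with
  | zero =>
    have hB : B t 1 = t := by simp [B, bN, S]
    have hA : A t 1 = 1 := by simp [A, aN, S]
    have : (Finset.Icc 1 t ×ˢ Finset.Icc 1 (1 * t)).filter
      (fun q => Nat.gcd q.2 q.1 = 1 ∧ q.2 * t < 1 * q.1) = ∅ := by
      apply Finset.eq_empty_of_forall_notMem
      intro q hq
      rw [mem_E _ _ _ ht] at hq
      obtain ⟨k1, k2, k3, k5, k6⟩ := hq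
      nlinarith
    rw [zero_add, hA, hB]
    unfold leftEnd
    rw [this]
    simp [xN]
  | succ n ih =>
    rw [show n + 1 + 1 = n + 2 from rfl, leftEnd_succ t ht, ih, ← edge_cast t ht, ← Int.cast_add]
    rfl

lemma classify (t : ℕ) (ht : 1 ≤ t) (n a b : ℕ) (ha : 1 ≤ a) (hbt : b ≤ t) (hc : Nat.gcd a b = 1) :
    (∃ i < n, (a, b) = (A t (i + 1), B t (i + 1))) ∨ A t (n + 1) * b ≤ B t (n + 1) * a := by
  induction n with
  | zero =>
    right
    have hB : B t 1 = t := by simp [B, bN, S]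
    have hA : A t 1 = 1 := by simp [A, aN, S]
    rw [zero_add, hA, hB]; nlinarith
  | succ n ih =>
    rcases ih with ⟨i, hi, he⟩ | hle
    · left; exact ⟨i, by omega, he⟩
    · rcases hle.eq_or_lt with he | hl
      · left
        obtain ⟨e1, e2⟩ := slope_eq a b _ _ hc (AB_cop t ht (n + 1)) (by linarith)
        exact ⟨n, by omega, by rw [← e1, ← e2]⟩
      · right
        exact trich t ht (n + 1) a b hbt hl

lemma xN_gap (t : ℕ) (ht : 1 ≤ t) (n : ℕ) : xN t n < xN t (n + 1) := by
  have := S_inv t (by exact_mod_cast ht) (n + 1)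
  have h1 : (1 : ℤ) ≤ t / bN t (n + 1) := by rw [Int.le_ediv_iff_mul_le (by omega)]; omega
  show xN t n < xN t n + _
  nlinarith

lemma xN_mono (t : ℕ) (ht : 1 ≤ t) : StrictMono (xN t) := strictMono_nat_of_lt_succ (xN_gap t ht)

lemma gR_sum (t : ℕ) (ht : 1 ≤ t) (n : ℕ) (x : ℝ) (hx : x ≤ xN t n) :
    gR t x = ∑ i ∈ Finset.range n, ((A t (i + 1) : ℝ) / B t (i + 1)) *
      min (max (x - xN t i) 0) (edgeLen t (B t (i + 1)) : ℝ) := by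
  unfold gR
  rw [tsum_eq_sum (s := (Finset.range n).image (fun i => (A t (i + 1), B t (i + 1))))]
  · rw [Finset.sum_image]
    · apply Finset.sum_congr rfl
      intro i _
      have := AB_inv t ht (i + 1)
      rw [if_pos ⟨A_pos t ht i, this.1, this.2.1, AB_cop t ht (i + 1)⟩]
      simp only
      rw [leftEnd_eq t ht]
    · intro i _ j _ hij
      have e : leftEnd t (A t (i + 1)) (B t (i + 1)) = leftEnd t (A t (j + 1)) (B t (j + 1)) := by
        simp only [Prod.mk.injEq] at hij
        rw [hij.1, hij.2]
      rw [leftEnd_eq t ht, leftEnd_eq t ht] at e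
      exact (xN_mono t ht).injective (by exact_mod_cast e)
  · rintro ⟨a, b⟩ hp
    split_ifs with hv
    · simp only at hv ⊢
      obtain ⟨v1, v2, v3, v4⟩ := hv
      rcases classify t ht n a b v1 v3 v4 with ⟨i, hi, he⟩ | hle
      · exfalso
        apply hp
        rw [Finset.mem_image]
        exact ⟨i, Finset.mem_range.2 hi, he.symm⟩
      · have := leftEnd_mono t a b (A t (n + 1)) (B t (n + 1)) v2 (AB_inv t ht (n + 1)).1 (by linarith)
        rw [leftEnd_eq t ht] at this
        rw [max_eq_right (by linarith), min_eq_left (by positivity), mul_zero]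
    · rfl

lemma gR_zero (t : ℕ) (ht : 1 ≤ t) (x : ℝ) (hx : x ≤ t) : gR t x = 0 := by
  rw [gR_sum t ht 0 x (by simpa [xN] using hx)]
  simp

lemma yN_cast (t : ℕ) (ht : 1 ≤ t) (n : ℕ) : (yN t n : ℝ) =
    ∑ i ∈ Finset.range n, ((A t (i + 1) : ℝ) / B t (i + 1)) * (edgeLen t (B t (i + 1)) : ℝ) := by
  induction n with
  | zero => simp [yN]
  | succ n ih =>
    rw [Finset.sum_range_succ, ← ih, ← edge_cast t ht]
    have h1 : (B t (n + 1) : ℝ) = bN t (n + 1) := by exact_mod_cast B_cast t ht (n + 1)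
    have h2 : (A t (n + 1) : ℝ) = aN t (n + 1) := by exact_mod_cast A_cast t ht (n + 1)
    have h3 : (B t (n + 1) : ℝ) ≠ 0 := by
      have := (AB_inv t ht (n + 1)).1
      exact_mod_cast (by omega : B t (n + 1) ≠ 0)
    rw [h1] at *
    rw [h2]
    show ((yN t n + t / bN t (n + 1) * aN t (n + 1) : ℤ) : ℝ) = _
    push_cast
    field_simp

lemma gR_lin (t : ℕ) (ht : 1 ≤ t) (n : ℕ) (x : ℝ) (h1 : xN t n ≤ x) (h2 : x ≤ xN t (n + 1)) :
    gR t x = yN t n + (aN t (n + 1) : ℝ) / bN t (n + 1) * (x - xN t n) := by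
  have e1 : (B t (n + 1) : ℝ) = bN t (n + 1) := by exact_mod_cast B_cast t ht (n + 1)
  have e2 : (A t (n + 1) : ℝ) = aN t (n + 1) := by exact_mod_cast A_cast t ht (n + 1)
  have hs : ∀ i, (xN t (i + 1) : ℝ) = xN t i + edgeLen t (B t (i + 1)) := by
    intro i
    rw [← edge_cast t ht, ← Int.cast_add]; rfl
  rw [gR_sum t ht (n + 1) x h2, Finset.sum_range_succ, yN_cast t ht, ← e1, ← e2]
  congr 1
  · apply Finset.sum_congr rfl
    intro i hi
    rw [Finset.mem_range] at hi
    have : (xN t (i + 1) : ℝ) ≤ xN t n := by exact_mod_cast (xN_mono t ht).monotone (by omega : i + 1 ≤ n)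
    have := hs i
    rw [min_eq_right]
    apply le_max_of_le_left
    linarith
  · have := hs n
    rw [max_eq_left (by linarith), min_eq_left (by linarith)]

lemma gp_lin (t : ℕ) (ht : 1 ≤ t) (j : ℤ) (x : ℝ) (h1 : xZ t j ≤ x) (h2 : x ≤ xZ t (j + 1)) :
    gridParabola t x = yZ t j + (aZ t (j + 1) : ℝ) / bZ t (j + 1) * (x - xZ t j) := by
  have ht' : (1 : ℝ) ≤ t := by exact_mod_cast ht
  have hxt : ∀ n, (t : ℝ) ≤ xN t n := by
    intro n
    have := (xN_mono t ht).monotone (Nat.zero_le n)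
    have h3 : (t : ℤ) ≤ xN t n := this
    exact_mod_cast h3
  unfold gridParabola
  rcases j with n | _ | n
  · simp only [xZ, yZ, os, aZ, bZ] at *
    have := hxt n
    rw [if_neg (by linarith)]
    exact gR_lin t ht n x h1 h2
  · simp [ns0, xZ, yZ, aZ, aN, bZ, xN, yN, S] at *
    split_ifs
    · exact gR_zero t ht _ (by linarith)
    · exact gR_zero t ht _ (by linarith)
  · rw [ns1] at *
    simp only [xZ, yZ, aZ, bZ] at *
    push_cast at h1 h2 ⊢
    have := hxt n
    rw [if_pos (by linarith), gR_lin t ht n _ (by linarith) (by linarith)]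
    have hb : (bN t (n + 1) : ℝ) ≠ 0 := by
      have := (S_inv t (by exact_mod_cast ht) (n + 1)).1
      exact_mod_cast (by omega : bN t (n + 1) ≠ 0)
    have e1 : (xN t (n + 1) : ℝ) = xN t n + ((t / bN t (n + 1) : ℤ) : ℝ) * bN t (n + 1) := by
      rw [← Int.cast_mul, ← Int.cast_add]; rfl
    have e2 : (yN t (n + 1) : ℝ) = yN t n + ((t / bN t (n + 1) : ℤ) : ℝ) * aN t (n + 1) := by
      rw [← Int.cast_mul, ← Int.cast_add]; rfl
    rw [e1, e2]
    field_simp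
    ring

def mkData (t : ℕ) (ht : 1 ≤ t) : Data (t : ℤ) ((t / 2 : ℕ) : ℤ) where
  C := chain t (by exact_mod_cast ht)
  hh := by omega
  h1 := by omega
  h2 := by omega

lemma U0_iff (t : ℕ) (ht : 1 ≤ t) (X Y : ℤ) : (mkData t ht).U 0 X Y ↔ gridParabola t X ≤ Y := by
  set D := mkData t ht
  obtain ⟨j, h1, h2⟩ := exists_between D.C.x
    (fun M => by
      obtain ⟨j0, hj⟩ := D.X_top 0 (M + (t / 2 : ℕ))
      refine ⟨j0, fun j hj' => ?_⟩
      have := hj j hj'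
      have := D.IZ 0 j
      unfold Data.X at *; omega)
    (fun M => by
      obtain ⟨j, hj⟩ := D.X_bot 0 (M - (t / 2 : ℕ))
      refine ⟨j, ?_⟩
      have := D.IZ 0 j
      unfold Data.X at *; omega) X
  rw [D.U_zero_iff j X Y h1 h2.le, gp_lin t ht j X (Int.cast_le.2 h1) (Int.cast_le.2 h2.le)]
  have hb : (0 : ℝ) < D.C.b (j + 1) := by exact_mod_cast (show 0 < D.C.b (j + 1) by linarith [D.C.hb (j + 1)])
  show _ ↔ (D.C.y j : ℝ) + (D.C.a (j + 1) : ℝ) / D.C.b (j + 1) * ((X : ℝ) - D.C.x j) ≤ Y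
  rw [← le_sub_iff_add_le', div_mul_eq_mul_div, div_le_iff₀ hb]
  rw [mul_comm (D.C.a (j + 1) : ℝ)]
  exact_mod_cast Iff.rfl

lemma iter (t : ℕ) (ht : 1 ≤ t) (n : ℕ) :
    peel^[n] (Ugrid (gridParabola t)) = (mkData t ht).US n := by
  induction n with
  | zero =>
    ext p
    constructor
    · rintro ⟨⟨i, j, rfl⟩, hg⟩
      exact ⟨i, j, rfl, (U0_iff t ht i j).2 hg⟩
    · rintro ⟨i, j, rfl, hg⟩
      exact ⟨⟨i, j, rfl⟩, (U0_iff t ht i j).1 hg⟩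
  | succ n ih =>
    rw [Function.iterate_succ_apply', ih]
    push_cast
    exact (mkData t ht).diff n

lemma iterN (t : ℕ) (ht : 1 ≤ t) (n : ℕ) (hn : n = 2 * (t / 2) + 1) :
    peel^[n] (Ugrid (gridParabola t)) = Ugrid (fun x => gridParabola t x + 1) := by
  rw [iter t ht]
  have hn' : (n : ℤ) = 2 * ((t / 2 : ℕ) : ℤ) + 1 := by omega
  rw [hn']
  ext p
  constructor
  · rintro ⟨i, j, rfl, hg⟩
    rw [Data.U_N, U0_iff] at hg
    refine ⟨⟨i, j, rfl⟩, ?_⟩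
    push_cast at hg
    show gridParabola t i + 1 ≤ j
    linarith
  · rintro ⟨⟨i, j, rfl⟩, hg⟩
    refine ⟨i, j, rfl, ?_⟩
    rw [Data.U_N, U0_iff]
    have : gridParabola t i + 1 ≤ j := hg
    push_cast
    linarith

end GP

/-- Grid peeling applied to the grid parabola P_t reproduces it one unit higher,
after t steps if t is odd, and after t+1 steps if t is even. -/
theorem gridParabola_reproduces (t : ℕ) (ht : 0 < t) :
    (Odd t →
      peel^[t] (Ugrid (gridParabola t)) = Ugrid (fun x => gridParabola t x + 1)) ∧
    (Even t →
      peel^[t + 1] (Ugrid (gridParabola t)) = Ugrid (fun x => gridParabola t x + 1)) := by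
  constructor
  · rintro ⟨k, hk⟩
    exact GP.iterN t ht t (by omega)
  · rintro ⟨k, hk⟩
    exact GP.iterN t ht (t + 1) (by omega)
end

section
/- There exists a constant C > 0 such that for every integer t ≥ 2 and every real α with 0 ≤ α ≤ 1, writing X_t(α) = Σ ⌊t/x⌋·x and Y_t(α) = Σ ⌊t/x⌋·y, where both sums are taken over all pairs of integers (x, y) with 1 ≤ x ≤ t, 1 ≤ y ≤ α·x, and gcd(x, y) = 1, one has |X_t(α) − (2ζ(3)/π²)·t³·α| ≤ C·t²·log t and |Y_t(α) − (ζ(3)/π²)·t³·α²| ≤ C·t²·log t. -/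
open scoped Classical

/-- ζ(3) = Σ_{n ≥ 1} 1/n³. -/
noncomputable def zeta3 : ℝ := ∑' n : ℕ, 1 / ((n : ℝ) + 1) ^ 3

/-- `X_t(α) = Σ ⌊t/x⌋·x` over primitive pairs (x,y) with 1 ≤ x ≤ t, 1 ≤ y ≤ α·x. -/
noncomputable def Xsum (t : ℕ) (α : ℝ) : ℝ :=
  ∑ x ∈ Finset.Icc 1 t, ∑ y ∈ Finset.Icc 1 t,
    if (y : ℝ) ≤ α * (x : ℝ) ∧ Nat.gcd x y = 1 then ((t / x : ℕ) : ℝ) * (x : ℝ) else 0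

/-- `Y_t(α) = Σ ⌊t/x⌋·y` over primitive pairs (x,y) with 1 ≤ x ≤ t, 1 ≤ y ≤ α·x. -/
noncomputable def Ysum (t : ℕ) (α : ℝ) : ℝ :=
  ∑ x ∈ Finset.Icc 1 t, ∑ y ∈ Finset.Icc 1 t,
    if (y : ℝ) ≤ α * (x : ℝ) ∧ Nat.gcd x y = 1 then ((t / x : ℕ) : ℝ) * (y : ℝ) else 0

section helpers
open Finset

lemma aux_box (f : ℕ → ℝ) (d n : ℕ) (hd : 1 ≤ d) :
    ∑ x ∈ Icc 1 n, (if d ∣ x then f x else 0) = ∑ x ∈ Icc 1 (n / d), f (d * x) := by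
  rw [← Finset.sum_filter]
  symm
  refine Finset.sum_bij (fun x _ => d * x) ?_ ?_ ?_ ?_
  · intro x hx
    simp only [mem_Icc, mem_filter] at hx ⊢
    refine ⟨⟨Nat.mul_pos hd hx.1, ?_⟩, Dvd.intro _ rfl⟩
    calc d * x ≤ d * (n / d) := Nat.mul_le_mul_left _ hx.2
      _ ≤ n := Nat.mul_div_le n d
  · intro a _ b _ h
    exact Nat.eq_of_mul_eq_mul_left hd h
  · intro b hb
    simp only [mem_Icc, mem_filter] at hb
    obtain ⟨⟨h1, h2⟩, c, rfl⟩ := hb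
    refine ⟨c, ?_, rfl⟩
    simp only [mem_Icc]
    refine ⟨Nat.pos_of_mul_pos_left h1 |> fun _ => ?_, (Nat.le_div_iff_mul_le hd).2 (by linarith)⟩
    rcases Nat.eq_zero_or_pos c with h | h
    · simp [h] at h1
    · exact h
  · intros; rfl

lemma aux_moeb (n x y : ℕ) (hx : 1 ≤ x) (hxn : x ≤ n) :
    ∑ d ∈ Icc 1 n, (if d ∣ x ∧ d ∣ y then (ArithmeticFunction.moebius d : ℝ) else 0)
      = if Nat.gcd x y = 1 then 1 else 0 := by
  have hg : Nat.gcd x y ≠ 0 := by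
    intro h; rw [Nat.gcd_eq_zero_iff] at h; omega
  have h := congrArg (fun F => F (Nat.gcd x y))
    (ArithmeticFunction.coe_moebius_mul_coe_zeta (R := ℝ))
  simp only [ArithmeticFunction.coe_mul_zeta_apply, ArithmeticFunction.one_apply,
    ArithmeticFunction.intCoe_apply] at h
  rw [← h, ← Finset.sum_filter]
  apply Finset.sum_congr _ (fun _ _ => rfl)
  ext d
  simp only [mem_filter, mem_Icc, Nat.mem_divisors]
  constructor
  · rintro ⟨_, h1, h2⟩
    exact ⟨Nat.dvd_gcd h1 h2, hg⟩
  · rintro ⟨h1, _⟩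
    have h2 := h1.trans (Nat.gcd_dvd_left x y)
    exact ⟨⟨Nat.pos_of_dvd_of_pos h2 hx, (Nat.le_of_dvd hx h2).trans hxn⟩, h2,
      h1.trans (Nat.gcd_dvd_right x y)⟩

/-- primitive sum -/
noncomputable def PP (w : ℕ → ℕ → ℝ) (α : ℝ) (n : ℕ) : ℝ :=
  ∑ x ∈ Icc 1 n, ∑ y ∈ Icc 1 n,
    if (y : ℝ) ≤ α * (x : ℝ) ∧ Nat.gcd x y = 1 then w x y else 0

/-- full sum -/
noncomputable def GG (w : ℕ → ℕ → ℝ) (α : ℝ) (n : ℕ) : ℝ :=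
  ∑ x ∈ Icc 1 n, ∑ y ∈ Icc 1 n, if (y : ℝ) ≤ α * (x : ℝ) then w x y else 0

lemma PP_eq (w : ℕ → ℕ → ℝ) (α : ℝ) (hw : ∀ d x y, w (d * x) (d * y) = d * w x y) (n : ℕ) :
    PP w α n = ∑ d ∈ Icc 1 n, (ArithmeticFunction.moebius d : ℝ) * (d * GG w α (n / d)) := by
  have h1 : PP w α n = ∑ x ∈ Icc 1 n, ∑ y ∈ Icc 1 n, ∑ d ∈ Icc 1 n,
      (ArithmeticFunction.moebius d : ℝ) * (if d ∣ x then (if d ∣ y then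
        (if (y : ℝ) ≤ α * (x : ℝ) then w x y else 0) else 0) else 0) := by
    unfold PP
    refine Finset.sum_congr rfl fun x hx => Finset.sum_congr rfl fun y hy => ?_
    simp only [mem_Icc] at hx
    have := aux_moeb n x y hx.1 hx.2
    have h2 : (if (y : ℝ) ≤ α * (x : ℝ) ∧ Nat.gcd x y = 1 then w x y else 0)
        = (if Nat.gcd x y = 1 then 1 else 0) * (if (y : ℝ) ≤ α * (x : ℝ) then w x y else 0) := by
      by_cases ha : Nat.gcd x y = 1 <;> by_cases hb : (y : ℝ) ≤ α * (x : ℝ) <;> simp [ha, hb]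
    rw [h2, ← this, Finset.sum_mul]
    refine Finset.sum_congr rfl fun d _ => ?_
    by_cases ha : d ∣ x <;> by_cases hb : d ∣ y <;> simp [ha, hb]
  rw [h1]
  have h3 : ∀ x ∈ Icc 1 n, (∑ y ∈ Icc 1 n, ∑ d ∈ Icc 1 n,
      (ArithmeticFunction.moebius d : ℝ) * (if d ∣ x then (if d ∣ y then
        (if (y : ℝ) ≤ α * (x : ℝ) then w x y else 0) else 0) else 0))
      = ∑ d ∈ Icc 1 n, (ArithmeticFunction.moebius d : ℝ) * (if d ∣ x then
        (∑ y ∈ Icc 1 n, if d ∣ y then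
        (if (y : ℝ) ≤ α * (x : ℝ) then w x y else 0) else 0) else 0) := by
    intro x _
    rw [Finset.sum_comm]
    refine Finset.sum_congr rfl fun d _ => ?_
    rw [← Finset.mul_sum]
    by_cases ha : d ∣ x <;> simp [ha]
  rw [Finset.sum_congr rfl h3, Finset.sum_comm]
  refine Finset.sum_congr rfl fun d hd => ?_
  simp only [mem_Icc] at hd
  rw [← Finset.mul_sum, aux_box _ d n hd.1]
  congr 1
  unfold GG
  rw [Finset.mul_sum]
  refine Finset.sum_congr rfl fun x _ => ?_
  rw [aux_box _ d n hd.1, Finset.mul_sum]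
  refine Finset.sum_congr rfl fun y _ => ?_
  have hd0 : (0 : ℝ) < d := by exact_mod_cast hd.1
  have : ((d * y : ℕ) : ℝ) ≤ α * ((d * x : ℕ) : ℝ) ↔ (y : ℝ) ≤ α * x := by
    push_cast
    rw [show α * ((d : ℝ) * x) = d * (α * x) by ring]
    exact mul_le_mul_iff_right₀ hd0
  simp only [this, hw]
  split_ifs <;> simp

lemma aux_shrink (f : ℕ → ℝ) (α : ℝ) (ha : α ≤ 1) (x m t : ℕ) (hx : x ≤ m) (hm : m ≤ t)
    (q : ℕ → Prop) [DecidablePred q] :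
    ∑ y ∈ Icc 1 t, (if (y : ℝ) ≤ α * (x : ℝ) ∧ q y then f y else 0)
      = ∑ y ∈ Icc 1 m, (if (y : ℝ) ≤ α * (x : ℝ) ∧ q y then f y else 0) := by
  symm
  apply Finset.sum_subset
  · intro y hy; simp only [mem_Icc] at *; omega
  · intro y hy hy'
    simp only [mem_Icc] at *
    rw [if_neg]
    rintro ⟨h, _⟩
    have : (y : ℝ) ≤ x := h.trans (by nlinarith [(Nat.cast_nonneg x : (0 : ℝ) ≤ x)])
    have : y ≤ x := by exact_mod_cast this
    omega

lemma sum_PP (w : ℕ → ℕ → ℝ) (α : ℝ) (ha : α ≤ 1) (t : ℕ) :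
    ∑ x ∈ Icc 1 t, ∑ y ∈ Icc 1 t,
      (if (y : ℝ) ≤ α * (x : ℝ) ∧ Nat.gcd x y = 1 then ((t / x : ℕ) : ℝ) * w x y else 0)
    = ∑ k ∈ Icc 1 t, PP w α (t / k) := by
  have h1 : ∀ k ∈ Icc 1 t, PP w α (t / k) = ∑ x ∈ Icc 1 (t / k), ∑ y ∈ Icc 1 t,
      (if (y : ℝ) ≤ α * (x : ℝ) ∧ Nat.gcd x y = 1 then w x y else 0) := by
    intro k _
    unfold PP
    refine Finset.sum_congr rfl fun x hx => ?_
    simp only [mem_Icc] at hx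
    exact (aux_shrink _ α ha x (t / k) t hx.2 (Nat.div_le_self _ _) _).symm
  rw [Finset.sum_congr rfl h1]
  have h2 : ∀ x ∈ Icc 1 t, ∑ y ∈ Icc 1 t,
      (if (y : ℝ) ≤ α * (x : ℝ) ∧ Nat.gcd x y = 1 then ((t / x : ℕ) : ℝ) * w x y else 0)
      = ∑ k ∈ Icc 1 (t / x), ∑ y ∈ Icc 1 t,
      (if (y : ℝ) ≤ α * (x : ℝ) ∧ Nat.gcd x y = 1 then w x y else 0) := by
    intro x _
    rw [Finset.sum_const, Nat.card_Icc, nsmul_eq_mul, Finset.mul_sum]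
    refine Finset.sum_congr rfl fun y _ => ?_
    split_ifs <;> simp
  rw [Finset.sum_congr rfl h2]
  apply Finset.sum_comm'
  intro x k
  simp only [mem_Icc]
  constructor
  · rintro ⟨⟨a, b⟩, c, d⟩
    have := (Nat.le_div_iff_mul_le a).1 d
    exact ⟨⟨a, (Nat.le_div_iff_mul_le c).2 (by linarith)⟩, c, d.trans (Nat.div_le_self _ _)⟩
  · rintro ⟨⟨a, b⟩, c, d⟩
    have := (Nat.le_div_iff_mul_le c).1 b
    exact ⟨⟨a, b.trans (Nat.div_le_self _ _)⟩, c, (Nat.le_div_iff_mul_le a).2 (by linarith)⟩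

/-- tail of a series bounded by inverse squares -/
lemma aux_tail (f : ℕ → ℝ) (s : ℝ) (hf : HasSum f s) (hb : ∀ n, |f n| ≤ ((n : ℝ) ^ 2)⁻¹)
    (n : ℕ) : |∑ d ∈ Icc 1 n, f d - s| ≤ 2 / (n + 1) := by
  have h0 : f 0 = 0 := by have := hb 0; simpa using this
  have ht := hf.tendsto_sum_nat
  have h2 : Filter.Tendsto (fun N => |∑ d ∈ Icc 1 n, f d - ∑ i ∈ range N, f i|) Filter.atTop
      (nhds |∑ d ∈ Icc 1 n, f d - s|) := (tendsto_const_nhds.sub ht).abs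
  refine le_of_tendsto h2 ?_
  filter_upwards [Filter.eventually_ge_atTop (n + 1)] with N hN
  have h3 : ∑ i ∈ range N, f i = ∑ d ∈ Icc 1 n, f d + ∑ i ∈ Ioo n N, f i := by
    have : range N = insert 0 (Icc 1 n ∪ Ioo n N) := by
      ext a; simp only [mem_range, mem_insert, mem_union, mem_Icc, mem_Ioo]; omega
    rw [this, Finset.sum_insert (by simp), Finset.sum_union, h0, zero_add]
    rw [Finset.disjoint_left]; intro a; simp only [mem_Icc, mem_Ioo]; omega
  rw [h3, sub_add_cancel_left, abs_neg]
  calc _ ≤ ∑ i ∈ Ioo n N, |f i| := Finset.abs_sum_le_sum_abs _ _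
    _ ≤ ∑ i ∈ Ioo n N, ((i : ℝ) ^ 2)⁻¹ := Finset.sum_le_sum fun i _ => hb i
    _ ≤ _ := sum_Ioo_inv_sq_le n N

lemma abs_moeb (d : ℕ) : |(ArithmeticFunction.moebius d : ℝ)| ≤ 1 := by
  exact_mod_cast ArithmeticFunction.abs_moebius_le_one (n := d)

lemma hasSum_moeb : HasSum (fun d : ℕ => (ArithmeticFunction.moebius d : ℝ) * ((d : ℝ) ^ 2)⁻¹)
    (6 / Real.pi ^ 2) := by
  have hs : (1 : ℝ) < (2 : ℂ).re := by norm_num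
  have h := ArithmeticFunction.LSeries_zeta_mul_Lseries_moebius hs
  rw [ArithmeticFunction.LSeries_zeta_eq_riemannZeta hs, riemannZeta_two] at h
  have h1 := (ArithmeticFunction.LSeriesSummable_moebius_iff.2 hs).hasSum
  have hpi : (Real.pi : ℂ) ≠ 0 := by exact_mod_cast Real.pi_ne_zero
  have h2 : LSeries (fun n => ((ArithmeticFunction.moebius n : ℤ) : ℂ)) 2
      = ((6 / Real.pi ^ 2 : ℝ) : ℂ) := by
    push_cast
    field_simp
    field_simp at h
    linear_combination h
  rw [← Complex.hasSum_ofReal]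
  have h3 : HasSum (LSeries.term (fun n => ((ArithmeticFunction.moebius n : ℤ) : ℂ)) 2)
      ((6 / Real.pi ^ 2 : ℝ) : ℂ) := by
    rw [← h2]; exact h1
  convert h3 using 1
  ext d
  rcases Nat.eq_zero_or_pos d with hd | hd
  · simp [hd]
  · rw [LSeries.term_of_ne_zero hd.ne']
    push_cast
    rw [div_eq_mul_inv]
    congr 2
    norm_cast

lemma hasSum_zeta3 : HasSum (fun d : ℕ => ((d : ℝ) ^ 3)⁻¹) zeta3 := by
  have hs : Summable (fun d : ℕ => ((d : ℝ) ^ 3)⁻¹) := Real.summable_nat_pow_inv.2 (by norm_num)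
  have : zeta3 = ∑' d : ℕ, ((d : ℝ) ^ 3)⁻¹ := by
    rw [hs.tsum_eq_zero_add]
    simp [zeta3]
  rw [this]
  exact hs.hasSum

lemma floor_cube (n d : ℕ) (hd : 1 ≤ d) :
    |((n / d : ℕ) : ℝ) ^ 3 - ((n : ℝ) / d) ^ 3| ≤ 3 * ((n : ℝ) / d) ^ 2 := by
  have hd0 : (0 : ℝ) < d := by exact_mod_cast hd
  have h1 : ((n / d : ℕ) : ℝ) ≤ (n : ℝ) / d := Nat.cast_div_le
  have h2 : (n : ℝ) / d ≤ ((n / d : ℕ) : ℝ) + 1 := by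
    rw [div_le_iff₀ hd0]
    have := Nat.lt_mul_div_succ n hd
    have : n ≤ (n / d + 1) * d := by rw [mul_comm]; exact this.le
    exact_mod_cast this
  have h0 : (0 : ℝ) ≤ ((n / d : ℕ) : ℝ) := Nat.cast_nonneg _
  generalize ((n / d : ℕ) : ℝ) = m at *
  generalize (n : ℝ) / d = u at *
  have e : m ^ 3 - u ^ 3 = -((u - m) * (u ^ 2 + u * m + m ^ 2)) := by ring
  have hu : 0 ≤ u := h0.trans h1
  have q : u ^ 2 + u * m + m ^ 2 ≤ 3 * u ^ 2 := by nlinarith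
  have q0 : 0 ≤ u ^ 2 + u * m + m ^ 2 := by positivity
  rw [e, abs_neg, abs_of_nonneg (mul_nonneg (by linarith) q0)]
  nlinarith

lemma sum_inv_le (n : ℕ) : ∑ d ∈ Icc 1 n, ((d : ℝ))⁻¹ ≤ 1 + Real.log n := by
  have := harmonic_le_one_add_log n
  rw [harmonic_eq_sum_Icc] at this
  push_cast at this
  exact this

lemma sum_inv_sq_le (n : ℕ) : ∑ d ∈ Icc 1 n, ((d : ℝ) ^ 2)⁻¹ ≤ 2 := by
  have := sum_Ioo_inv_sq_le (α := ℝ) 0 (n + 1)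
  have e : Ioo 0 (n + 1) = Icc 1 n := by ext a; simp only [mem_Ioo, mem_Icc]; omega
  rw [e] at this
  simpa using this

lemma PP_est (P G : ℕ → ℝ) (a : ℝ) (ha0 : 0 ≤ a) (ha1 : a ≤ 1)
    (hP : ∀ n, P n = ∑ d ∈ Icc 1 n, (ArithmeticFunction.moebius d : ℝ) * (d * G (n / d)))
    (hG : ∀ n, |G n - a * (n : ℝ) ^ 3| ≤ 3 * (n : ℝ) ^ 2) (n : ℕ) :
    |P n - a * (6 / Real.pi ^ 2) * (n : ℝ) ^ 3| ≤ 8 * (n : ℝ) ^ 2 * (1 + Real.log n) := by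
  rcases Nat.eq_zero_or_pos n with hn | hn
  · subst hn; simp [hP]
  have hn1 : (1 : ℝ) ≤ n := by exact_mod_cast hn
  have hlog : 0 ≤ Real.log n := Real.log_nonneg hn1
  have hterm : ∀ d ∈ Icc 1 n, |(ArithmeticFunction.moebius d : ℝ) * (d * G (n / d))
      - a * (n : ℝ) ^ 3 * ((ArithmeticFunction.moebius d : ℝ) * ((d : ℝ) ^ 2)⁻¹)|
      ≤ 6 * (n : ℝ) ^ 2 * (d : ℝ)⁻¹ := by
    intro d hd
    simp only [mem_Icc] at hd
    have hd0 : (0 : ℝ) < d := by exact_mod_cast hd.1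
    have h1 : |G (n / d) - a * ((n : ℝ) / d) ^ 3| ≤ 6 * ((n : ℝ) / d) ^ 2 := by
      have e1 := hG (n / d)
      have e2 := floor_cube n d hd.1
      have e3 : (((n / d : ℕ) : ℝ)) ^ 2 ≤ ((n : ℝ) / d) ^ 2 := by
        gcongr; exact Nat.cast_div_le
      have e4 : G (n / d) - a * ((n : ℝ) / d) ^ 3 = (G (n / d) - a * ((n / d : ℕ) : ℝ) ^ 3)
        + a * (((n / d : ℕ) : ℝ) ^ 3 - ((n : ℝ) / d) ^ 3) := by ring
      rw [e4]
      refine (abs_add_le _ _).trans ?_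
      rw [abs_mul, abs_of_nonneg ha0]
      have := mul_le_of_le_one_left (abs_nonneg (((n / d : ℕ) : ℝ) ^ 3 - ((n : ℝ) / d) ^ 3)) ha1
      linarith
    have e : (ArithmeticFunction.moebius d : ℝ) * (d * G (n / d))
      - a * (n : ℝ) ^ 3 * ((ArithmeticFunction.moebius d : ℝ) * ((d : ℝ) ^ 2)⁻¹)
      = (ArithmeticFunction.moebius d : ℝ) * (d * (G (n / d) - a * ((n : ℝ) / d) ^ 3)) := by
      field_simp
    rw [e, abs_mul, abs_mul, abs_of_pos hd0]
    calc _ ≤ 1 * ((d : ℝ) * (6 * ((n : ℝ) / d) ^ 2)) := by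
          gcongr
          exact abs_moeb d
      _ = _ := by field_simp
  have hsum : |P n - a * (n : ℝ) ^ 3 * ∑ d ∈ Icc 1 n,
      ((ArithmeticFunction.moebius d : ℝ) * ((d : ℝ) ^ 2)⁻¹)|
      ≤ 6 * (n : ℝ) ^ 2 * (1 + Real.log n) := by
    rw [hP, Finset.mul_sum, ← Finset.sum_sub_distrib]
    refine (Finset.abs_sum_le_sum_abs _ _).trans ((Finset.sum_le_sum hterm).trans ?_)
    rw [← Finset.mul_sum]
    gcongr
    exact sum_inv_le n
  have htail := aux_tail _ _ hasSum_moeb (fun d => by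
    rw [abs_mul, abs_of_nonneg (by positivity : (0 : ℝ) ≤ ((d : ℝ) ^ 2)⁻¹)]
    exact mul_le_of_le_one_left (by positivity) (abs_moeb d)) n
  set S := ∑ d ∈ Icc 1 n, ((ArithmeticFunction.moebius d : ℝ) * ((d : ℝ) ^ 2)⁻¹)
  have e : P n - a * (6 / Real.pi ^ 2) * (n : ℝ) ^ 3
      = (P n - a * (n : ℝ) ^ 3 * S) + a * (n : ℝ) ^ 3 * (S - 6 / Real.pi ^ 2) := by ring
  rw [e]
  refine (abs_add_le _ _).trans ?_
  rw [abs_mul (a * (n : ℝ) ^ 3), abs_of_nonneg (by positivity : 0 ≤ a * (n : ℝ) ^ 3)]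
  have : a * (n : ℝ) ^ 3 * |S - 6 / Real.pi ^ 2| ≤ 2 * (n : ℝ) ^ 2 := by
    calc _ ≤ 1 * (n : ℝ) ^ 3 * (2 / (n + 1)) := by gcongr
      _ ≤ 1 * (n : ℝ) ^ 3 * (2 / n) := by gcongr; linarith
      _ = _ := by field_simp
  nlinarith [mul_nonneg (sq_nonneg (n : ℝ)) hlog]

lemma six_pi : 0 ≤ 6 / Real.pi ^ 2 ∧ 6 / Real.pi ^ 2 ≤ 1 := by
  refine ⟨by positivity, ?_⟩
  rw [div_le_one (by positivity)]
  nlinarith [Real.pi_gt_three]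

lemma final_est (P : ℕ → ℝ) (b : ℝ) (hb0 : 0 ≤ b) (hb1 : b ≤ 1)
    (hP : ∀ n : ℕ, |P n - b * (n : ℝ) ^ 3| ≤ 8 * (n : ℝ) ^ 2 * (1 + Real.log n))
    (t : ℕ) (ht : 2 ≤ t) :
    |∑ k ∈ Icc 1 t, P (t / k) - b * zeta3 * (t : ℝ) ^ 3| ≤ 100 * (t : ℝ) ^ 2 * Real.log t := by
  have ht0 : (0 : ℝ) < t := by exact_mod_cast (by omega : 0 < t)
  have hlog2 : (1 / 2 : ℝ) ≤ Real.log t := by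
    have h1 : Real.log 2 ≤ Real.log t := Real.log_le_log (by norm_num) (by exact_mod_cast ht)
    have := Real.log_two_gt_d9
    linarith
  have hterm : ∀ k ∈ Icc 1 t, |P (t / k) - b * (t : ℝ) ^ 3 * ((k : ℝ) ^ 3)⁻¹|
      ≤ 11 * (t : ℝ) ^ 2 * (1 + Real.log t) * ((k : ℝ) ^ 2)⁻¹ := by
    intro k hk
    simp only [mem_Icc] at hk
    have hk0 : (0 : ℝ) < k := by exact_mod_cast hk.1
    have e1 := hP (t / k)
    have e2 := floor_cube t k hk.1
    have e3 : (((t / k : ℕ) : ℝ)) ^ 2 ≤ ((t : ℝ) / k) ^ 2 := by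
      gcongr; exact Nat.cast_div_le
    have hq : 1 ≤ t / k := (Nat.le_div_iff_mul_le hk.1).2 (by linarith)
    have e5 : Real.log ((t / k : ℕ) : ℝ) ≤ Real.log t := by
      apply Real.log_le_log
      · exact_mod_cast hq
      · exact_mod_cast Nat.div_le_self t k
    have e6 : 0 ≤ Real.log ((t / k : ℕ) : ℝ) := Real.log_nonneg (by exact_mod_cast hq)
    have e4 : P (t / k) - b * (t : ℝ) ^ 3 * ((k : ℝ) ^ 3)⁻¹
      = (P (t / k) - b * ((t / k : ℕ) : ℝ) ^ 3)
        + b * (((t / k : ℕ) : ℝ) ^ 3 - ((t : ℝ) / k) ^ 3) := by rw [div_pow]; ring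
    rw [e4]
    refine (abs_add_le _ _).trans ?_
    rw [abs_mul, abs_of_nonneg hb0]
    have e7 := mul_le_of_le_one_left (abs_nonneg (((t / k : ℕ) : ℝ) ^ 3 - ((t : ℝ) / k) ^ 3)) hb1
    have e8 : 8 * ((t / k : ℕ) : ℝ) ^ 2 * (1 + Real.log ((t / k : ℕ) : ℝ))
      ≤ 8 * ((t : ℝ) / k) ^ 2 * (1 + Real.log t) := by gcongr
    have e9 : 11 * (t : ℝ) ^ 2 * (1 + Real.log t) * ((k : ℝ) ^ 2)⁻¹
      = 11 * ((t : ℝ) / k) ^ 2 * (1 + Real.log t) := by rw [div_pow]; ring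
    rw [e9]
    nlinarith [mul_nonneg (sq_nonneg ((t : ℝ) / k)) (by linarith : 0 ≤ Real.log t)]
  have hsum : |∑ k ∈ Icc 1 t, P (t / k) - b * (t : ℝ) ^ 3 * ∑ k ∈ Icc 1 t, ((k : ℝ) ^ 3)⁻¹|
      ≤ 11 * (t : ℝ) ^ 2 * (1 + Real.log t) * 2 := by
    rw [Finset.mul_sum, ← Finset.sum_sub_distrib]
    refine (Finset.abs_sum_le_sum_abs _ _).trans ((Finset.sum_le_sum hterm).trans ?_)
    rw [← Finset.mul_sum]
    gcongr
    exact sum_inv_sq_le t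
  have htail := aux_tail _ _ hasSum_zeta3 (fun d => by
    rw [abs_of_nonneg (by positivity)]
    rcases Nat.eq_zero_or_pos d with hd | hd
    · simp [hd]
    · have : (1 : ℝ) ≤ d := by exact_mod_cast hd
      gcongr
      · norm_num) t
  set S := ∑ k ∈ Icc 1 t, ((k : ℝ) ^ 3)⁻¹
  have e : ∑ k ∈ Icc 1 t, P (t / k) - b * zeta3 * (t : ℝ) ^ 3
      = (∑ k ∈ Icc 1 t, P (t / k) - b * (t : ℝ) ^ 3 * S) + b * (t : ℝ) ^ 3 * (S - zeta3) := by ring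
  rw [e]
  refine (abs_add_le _ _).trans ?_
  rw [abs_mul (b * (t : ℝ) ^ 3), abs_of_nonneg (by positivity : 0 ≤ b * (t : ℝ) ^ 3)]
  have : b * (t : ℝ) ^ 3 * |S - zeta3| ≤ 2 * (t : ℝ) ^ 2 := by
    calc _ ≤ 1 * (t : ℝ) ^ 3 * (2 / (t + 1)) := by gcongr
      _ ≤ 1 * (t : ℝ) ^ 3 * (2 / t) := by gcongr; linarith
      _ = _ := by field_simp
  nlinarith [mul_le_mul_of_nonneg_left hlog2 (sq_nonneg (t : ℝ))]

lemma GG_est (w : ℕ → ℕ → ℝ) (α a : ℝ) (hα : α ≤ 1) (ha0 : 0 ≤ a) (ha1 : a ≤ 1)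
    (hg : ∀ x : ℕ, |∑ y ∈ Icc 1 x, (if (y : ℝ) ≤ α * (x : ℝ) then w x y else 0)
      - 3 * a * (x : ℝ) ^ 2| ≤ (x : ℝ)) (n : ℕ) :
    |GG w α n - a * (n : ℝ) ^ 3| ≤ 3 * (n : ℝ) ^ 2 := by
  have h1 : GG w α n = ∑ x ∈ Icc 1 n, ∑ y ∈ Icc 1 x,
      (if (y : ℝ) ≤ α * (x : ℝ) then w x y else 0) := by
    unfold GG
    refine Finset.sum_congr rfl fun x hx => ?_
    simp only [mem_Icc] at hx
    simpa using aux_shrink (w x) α hα x x n le_rfl hx.2 (fun _ => True)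
  have s1 : ∀ n : ℕ, ∑ x ∈ Icc 1 n, (x : ℝ) = n * (n + 1) / 2 := by
    intro n
    induction n with
    | zero => simp
    | succ k ih => rw [Finset.sum_Icc_succ_top (by omega), ih]; push_cast; ring
  have s2 : ∀ n : ℕ, ∑ x ∈ Icc 1 n, (x : ℝ) ^ 2 = n * (n + 1) * (2 * n + 1) / 6 := by
    intro n
    induction n with
    | zero => simp
    | succ k ih => rw [Finset.sum_Icc_succ_top (by omega), ih]; push_cast; ring
  have h2 : |GG w α n - 3 * a * ∑ x ∈ Icc 1 n, (x : ℝ) ^ 2| ≤ n * (n + 1) / 2 := by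
    rw [h1, Finset.mul_sum, ← Finset.sum_sub_distrib, ← s1]
    exact (Finset.abs_sum_le_sum_abs _ _).trans (Finset.sum_le_sum fun x _ => hg x)
  rw [s2] at h2
  have hn : (n : ℝ) ≤ (n : ℝ) ^ 2 := by
    exact_mod_cast Nat.le_self_pow (by norm_num) n
  have hn0 : (0 : ℝ) ≤ n := Nat.cast_nonneg n
  have h3 : a * (3 * (n : ℝ) ^ 2 + n) ≤ 3 * (n : ℝ) ^ 2 + n :=
    mul_le_of_le_one_left (by positivity) ha1
  have h4 : 0 ≤ a * (3 * (n : ℝ) ^ 2 + n) := by positivity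
  rw [abs_le] at h2 ⊢
  constructor <;> nlinarith

lemma filt (f : ℕ → ℝ) (α : ℝ) (h0 : 0 ≤ α) (h1 : α ≤ 1) (x : ℕ) :
    ∑ y ∈ Icc 1 x, (if (y : ℝ) ≤ α * (x : ℝ) then f y else 0)
      = ∑ y ∈ Icc 1 ⌊α * x⌋₊, f y := by
  rw [← Finset.sum_filter]
  apply Finset.sum_congr _ (fun _ _ => rfl)
  have hx : (0 : ℝ) ≤ x := Nat.cast_nonneg x
  have hle : ⌊α * x⌋₊ ≤ x := by
    apply Nat.floor_le_of_le; nlinarith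
  ext y
  simp only [mem_filter, mem_Icc]
  rw [← Nat.le_floor_iff (by positivity)]
  omega

lemma gX (α : ℝ) (h0 : 0 ≤ α) (h1 : α ≤ 1) (x : ℕ) :
    |∑ y ∈ Icc 1 x, (if (y : ℝ) ≤ α * (x : ℝ) then (x : ℝ) else 0)
      - 3 * (α / 3) * (x : ℝ) ^ 2| ≤ (x : ℝ) := by
  rw [filt (fun _ => (x : ℝ)) α h0 h1, Finset.sum_const, Nat.card_Icc, nsmul_eq_mul,
    Nat.add_sub_cancel]
  have hx : (0 : ℝ) ≤ x := Nat.cast_nonneg x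
  have a1 := Nat.floor_le (by positivity : 0 ≤ α * x)
  have a2 := (Nat.lt_floor_add_one (α * x)).le
  rw [abs_le]
  constructor <;> nlinarith

lemma gY (α : ℝ) (h0 : 0 ≤ α) (h1 : α ≤ 1) (x : ℕ) :
    |∑ y ∈ Icc 1 x, (if (y : ℝ) ≤ α * (x : ℝ) then (y : ℝ) else 0)
      - 3 * (α ^ 2 / 6) * (x : ℝ) ^ 2| ≤ (x : ℝ) := by
  have s1 : ∀ n : ℕ, ∑ x ∈ Icc 1 n, (x : ℝ) = n * (n + 1) / 2 := by
    intro n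
    induction n with
    | zero => simp
    | succ k ih => rw [Finset.sum_Icc_succ_top (by omega), ih]; push_cast; ring
  rw [filt (fun y => (y : ℝ)) α h0 h1, s1]
  have hx : (0 : ℝ) ≤ x := Nat.cast_nonneg x
  have a0 : 0 ≤ α * x := by positivity
  have a1 := Nat.floor_le a0
  have a2 := (Nat.lt_floor_add_one (α * x)).le
  have a3 : α * x ≤ x := by nlinarith
  have a4 : (0 : ℝ) ≤ (⌊α * x⌋₊ : ℝ) := Nat.cast_nonneg _
  rw [show 3 * (α ^ 2 / 6) * (x : ℝ) ^ 2 = (α * x) ^ 2 / 2 by ring]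
  generalize (⌊α * x⌋₊ : ℝ) = N at *
  generalize α * (x : ℝ) = u at *
  rw [abs_le]
  constructor <;> nlinarith

lemma combined (w : ℕ → ℕ → ℝ) (α a : ℝ) (hw : ∀ d x y, w (d * x) (d * y) = d * w x y)
    (hα : α ≤ 1) (ha0 : 0 ≤ a) (ha1 : a ≤ 1)
    (hg : ∀ x : ℕ, |∑ y ∈ Icc 1 x, (if (y : ℝ) ≤ α * (x : ℝ) then w x y else 0)
      - 3 * a * (x : ℝ) ^ 2| ≤ (x : ℝ)) (t : ℕ) (ht : 2 ≤ t) :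
    |∑ x ∈ Icc 1 t, ∑ y ∈ Icc 1 t,
      (if (y : ℝ) ≤ α * (x : ℝ) ∧ Nat.gcd x y = 1 then ((t / x : ℕ) : ℝ) * w x y else 0)
      - a * (6 / Real.pi ^ 2) * zeta3 * (t : ℝ) ^ 3| ≤ 100 * (t : ℝ) ^ 2 * Real.log t := by
  rw [sum_PP w α hα t]
  exact final_est (PP w α) _ (mul_nonneg ha0 six_pi.1)
    (mul_le_one₀ ha1 six_pi.1 six_pi.2)
    (PP_est (PP w α) (GG w α) a ha0 ha1 (PP_eq w α hw) (GG_est w α a hα ha0 ha1 hg)) t ht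

end helpers

/-- Asymptotics for the coordinates of the vector `U_t^α`. -/
theorem U_asymptotics :
    ∃ C : ℝ, 0 < C ∧ ∀ (t : ℕ) (α : ℝ), 2 ≤ t → 0 ≤ α → α ≤ 1 →
      |Xsum t α - 2 * zeta3 / Real.pi ^ 2 * (t : ℝ) ^ 3 * α| ≤ C * (t : ℝ) ^ 2 * Real.log t ∧
      |Ysum t α - zeta3 / Real.pi ^ 2 * (t : ℝ) ^ 3 * α ^ 2| ≤ C * (t : ℝ) ^ 2 * Real.log t := by
  refine ⟨100, by norm_num, ?_⟩
  intro t α ht h0 h1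
  constructor
  · have h := combined (fun x _ => (x : ℝ)) α (α / 3) (by intros; push_cast; ring) h1
      (by linarith) (by linarith) (gX α h0 h1) t ht
    have e : 2 * zeta3 / Real.pi ^ 2 * (t : ℝ) ^ 3 * α
      = α / 3 * (6 / Real.pi ^ 2) * zeta3 * (t : ℝ) ^ 3 := by ring
    rw [e]
    exact h
  · have h := combined (fun _ y => (y : ℝ)) α (α ^ 2 / 6) (by intros; push_cast; ring) h1
      (by positivity) (by nlinarith) (gY α h0 h1) t ht
    have e : zeta3 / Real.pi ^ 2 * (t : ℝ) ^ 3 * α ^ 2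
      = α ^ 2 / 6 * (6 / Real.pi ^ 2) * zeta3 * (t : ℝ) ^ 3 := by ring
    rw [e]
    exact h
end

section
/- There exists a constant C > 0 such that for every integer t ≥ 2, |H_t − (2ζ(3)/π²)·t³| ≤ C·t²·log t. In particular, H_t ~ (2ζ(3)/π²)·t³ as t → ∞. -/
/-- The horizontal period `H_t = Σ ⌊t/x⌋·x` over pairs `1 ≤ y ≤ x ≤ t` with `gcd(x,y) = 1`. -/
def Hper (t : ℕ) : ℕ :=
  ∑ p ∈ (Finset.Icc 1 t ×ˢ Finset.Icc 1 t).filter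
      (fun p => p.2 ≤ p.1 ∧ Nat.gcd p.1 p.2 = 1),
    (t / p.1) * p.1

open ArithmeticFunction in
/-- `h(n) = μ(n) n`. -/
def HperAux.h : ArithmeticFunction ℤ :=
  (ArithmeticFunction.moebius).pmul ((ArithmeticFunction.id : ArithmeticFunction ℕ) : ArithmeticFunction ℤ)

/-- `g(n) = Σ_{d ∣ n} μ(d) d`. -/
def HperAux.g : ArithmeticFunction ℤ :=
  ((ArithmeticFunction.zeta : ArithmeticFunction ℕ) : ArithmeticFunction ℤ) * HperAux.h

namespace HperAux

/-- `n φ(n)`. -/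
def ph : ArithmeticFunction ℤ := ⟨fun n => (n : ℤ) * (n.totient : ℤ), by simp⟩

/-- `n ^ 2`. -/
def sq : ArithmeticFunction ℤ := ⟨fun n => (n : ℤ) ^ 2, by simp⟩

lemma h_apply (n : ℕ) : h n = ArithmeticFunction.moebius n * (n : ℤ) := by
  simp [h, ArithmeticFunction.pmul_apply]

lemma h_mult : h.IsMultiplicative :=
  ArithmeticFunction.isMultiplicative_moebius.pmul ArithmeticFunction.isMultiplicative_id.natCast

lemma g_mult : g.IsMultiplicative :=
  ArithmeticFunction.isMultiplicative_zeta.natCast.mul h_mult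

lemma g_apply (n : ℕ) : g n = ∑ d ∈ n.divisors, h d := by
  rw [g, ArithmeticFunction.coe_zeta_mul_apply]

lemma g_prime_pow (p k : ℕ) (hp : p.Prime) (hk : 0 < k) : g (p ^ k) = 1 - p := by
  rw [g_apply, Nat.sum_divisors_prime_pow hp]
  obtain ⟨m, rfl⟩ : ∃ m, k = m + 1 := ⟨k - 1, by omega⟩
  rw [Finset.sum_range_succ', Finset.sum_range_succ']
  rw [Finset.sum_eq_zero]
  · simp [h_apply, ArithmeticFunction.moebius_apply_prime hp]; ring
  · intro i _
    rw [h_apply, ArithmeticFunction.moebius_apply_prime_pow hp (by omega)]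
    simp

lemma abs_g_le (n : ℕ) : |g n| ≤ n := by
  induction n using Nat.recOnPosPrimePosCoprime with
  | prime_pow p k hp hk =>
    rw [g_prime_pow p k hp hk]
    have h1 : (1 : ℤ) ≤ p := by exact_mod_cast hp.one_le
    have h2 : (p : ℤ) ≤ ((p ^ k : ℕ) : ℤ) := by
      exact_mod_cast Nat.le_self_pow hk.ne' p
    rw [abs_le]; constructor <;> linarith
  | zero => simp
  | one => simp [g_mult.map_one]
  | coprime a b _ _ hab iha ihb =>
    rw [g_mult.map_mul_of_coprime hab, abs_mul]
    push_cast
    exact mul_le_mul iha ihb (abs_nonneg _) (by positivity)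

lemma h_mul_sq : h * sq = ph := by
  ext n
  rcases Nat.eq_zero_or_pos n with rfl | hn
  · simp
  have key := (ArithmeticFunction.sum_eq_iff_sum_mul_moebius_eq
    (f := fun n => (n.totient : ℤ)) (g := fun n => (n : ℤ))).1 (by
      intro n _
      exact_mod_cast Nat.sum_totient n) n hn
  simp only [ArithmeticFunction.mul_apply]
  change _ = (n : ℤ) * (n.totient : ℤ)
  rw [← key, Finset.mul_sum]
  refine Finset.sum_congr rfl fun x hx => ?_
  have := (Nat.mem_divisorsAntidiagonal.1 hx).1
  rw [h_apply]
  change _ * (x.2 : ℤ) ^ 2 = _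
  rw [← this]
  push_cast
  ring

lemma Hper_eq (t : ℕ) : (Hper t : ℤ) = ∑ n ∈ Finset.Ioc 0 t, ph n * ((t / n : ℕ) : ℤ) := by
  unfold Hper
  rw [Finset.sum_filter, Finset.sum_product]
  push_cast
  refine Finset.sum_congr (by ext; simp [Nat.succ_le_iff]) fun x hx => ?_
  have hx' := Finset.mem_Ioc.1 hx
  rw [← Finset.sum_filter, Finset.sum_const]
  have : (Finset.filter (fun y => y ≤ x ∧ Nat.gcd x y = 1) (Finset.Icc 1 t)).card = x.totient := by
    rw [← Nat.filter_coprime_Ico_eq_totient x 1]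
    congr 1
    ext y
    simp [Nat.Coprime]
    omega
  change _ = ((x : ℤ) * (x.totient : ℤ)) * _
  rw [nsmul_eq_mul, this]
  push_cast
  ring

lemma Hper_eq' (t : ℕ) : (Hper t : ℤ) =
    ∑ n ∈ Finset.Ioc 0 t, g n * ∑ m ∈ Finset.Ioc 0 (t / n), (m : ℤ) ^ 2 := by
  rw [Hper_eq, ← ArithmeticFunction.sum_Ioc_mul_zeta_eq_sum, ← h_mul_sq]
  have : h * sq * ((ArithmeticFunction.zeta : ArithmeticFunction ℕ) : ArithmeticFunction ℤ)
      = g * sq := by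
    rw [g]; ring
  rw [this, ArithmeticFunction.sum_Ioc_mul_eq_sum_sum]
  rfl

lemma sum_sq (m : ℕ) : ∑ k ∈ Finset.Ioc 0 m, (k : ℝ) ^ 2 = m * (m + 1) * (2 * m + 1) / 6 := by
  induction m with
  | zero => simp
  | succ n ih =>
    rw [Finset.sum_Ioc_succ_top (by omega), ih]; push_cast; ring

lemma sum_sq_bound (t n : ℕ) (hn : 0 < n) (hnt : n ≤ t) :
    |∑ k ∈ Finset.Ioc 0 (t / n), (k : ℝ) ^ 2 - ((t : ℝ) / n) ^ 3 / 3| ≤ 3 * ((t : ℝ) / n) ^ 2 := by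
  rw [sum_sq]
  have hn' : (0 : ℝ) < n := by exact_mod_cast hn
  have h1 : ((t / n : ℕ) : ℝ) ≤ (t : ℝ) / n := Nat.cast_div_le
  have h2 : (t : ℝ) / n ≤ ((t / n : ℕ) : ℝ) + 1 := by
    rw [div_le_iff₀ hn']
    have := Nat.lt_div_mul_add (a := t) hn
    have : t ≤ (t / n + 1) * n := by rw [add_mul]; omega
    exact_mod_cast this
  have h3 : (1 : ℝ) ≤ ((t / n : ℕ) : ℝ) := by
    exact_mod_cast (Nat.one_le_div_iff hn).2 hnt
  generalize ((t / n : ℕ) : ℝ) = m at *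
  generalize (t : ℝ) / n = u at *
  have h4 : m ^ 3 ≤ u ^ 3 := pow_le_pow_left₀ (by linarith) h1 3
  have h5 : u ^ 3 ≤ (m + 1) ^ 3 := pow_le_pow_left₀ (by linarith) h2 3
  have h6 : m ^ 2 ≤ u ^ 2 := pow_le_pow_left₀ (by linarith) h1 2
  rw [abs_le]
  constructor <;> nlinarith

open ArithmeticFunction in
lemma lseries_h : LSeriesHasSum (fun n => ((h n : ℤ) : ℂ)) 3 (6 / (Real.pi : ℂ) ^ 2) := by
  have hs : LSeriesSummable (fun n => ((ArithmeticFunction.moebius n : ℤ) : ℂ)) 2 :=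
    LSeriesSummable_moebius_iff.2 (by norm_num)
  have h1 := LSeries_zeta_mul_Lseries_moebius (s := 2) (by norm_num)
  rw [LSeries_zeta_eq_riemannZeta (by norm_num), riemannZeta_two] at h1
  have h2 := hs.LSeriesHasSum
  have hpi : (Real.pi : ℂ) ≠ 0 := by exact_mod_cast Real.pi_ne_zero
  have h3 : LSeries (fun n => ((ArithmeticFunction.moebius n : ℤ) : ℂ)) 2
      = 6 / (Real.pi : ℂ) ^ 2 := by
    field_simp at h1 ⊢
    linear_combination h1
  rw [h3] at h2
  unfold LSeriesHasSum at h2 ⊢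
  convert h2 using 1
  ext n
  rcases Nat.eq_zero_or_pos n with rfl | hn
  · simp
  have hn' : (n : ℂ) ≠ 0 := by exact_mod_cast hn.ne'
  rw [LSeries.term_of_ne_zero hn.ne', LSeries.term_of_ne_zero hn.ne', h_apply]
  rw [show (3 : ℂ) = ((3 : ℕ) : ℂ) by norm_num, show (2 : ℂ) = ((2 : ℕ) : ℂ) by norm_num,
    Complex.cpow_natCast, Complex.cpow_natCast]
  push_cast
  field_simp

open ArithmeticFunction in
lemma lseries_g : LSeriesHasSum (fun n => ((g n : ℤ) : ℂ)) 3 (zeta3 * (6 / (Real.pi : ℂ) ^ 2)) := by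
  have hz : LSeriesHasSum (fun n => ((ArithmeticFunction.zeta n : ℕ) : ℂ)) 3 (zeta3 : ℂ) := by
    have := (LSeriesSummable_zeta_iff (s := 3)).2 (by norm_num)
    have h2 := this.LSeriesHasSum
    rw [LSeries_zeta_eq_riemannZeta (by norm_num),
      zeta_eq_tsum_one_div_nat_add_one_cpow (by norm_num)] at h2
    convert h2 using 1
    rw [zeta3, Complex.ofReal_tsum]
    refine tsum_congr fun n => ?_
    rw [show (3 : ℂ) = ((3 : ℕ) : ℂ) by norm_num, Complex.cpow_natCast]
    push_cast
    rfl
  have := LSeriesHasSum_mul (f := ((ArithmeticFunction.zeta : ArithmeticFunction ℕ) : ArithmeticFunction ℂ))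
    (g := (h : ArithmeticFunction ℂ)) (s := 3) (by simpa using hz) (by simpa using lseries_h)
  convert this using 2 with n
  simp only [g, mul_apply, natCoe_apply, intCoe_apply]
  push_cast
  rfl

lemma hasSum_g : HasSum (fun n : ℕ => (g n : ℝ) / (n : ℝ) ^ 3) (zeta3 * (6 / Real.pi ^ 2)) := by
  have h := lseries_g
  unfold LSeriesHasSum at h
  rw [← Complex.hasSum_ofReal]
  push_cast
  convert h using 1
  ext n
  rcases Nat.eq_zero_or_pos n with rfl | hn
  · simp
  rw [LSeries.term_of_ne_zero hn.ne', show (3 : ℂ) = ((3 : ℕ) : ℂ) by norm_num,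
    Complex.cpow_natCast]

lemma abs_g_le' (n : ℕ) : |(g n : ℝ)| ≤ n := by exact_mod_cast abs_g_le n

lemma tail (t : ℕ) (ht : 0 < t) :
    |∑ n ∈ Finset.Ioc 0 t, (g n : ℝ) / (n : ℝ) ^ 3 - zeta3 * (6 / Real.pi ^ 2)| ≤ 1 / (t : ℝ) := by
  have h1 := (hasSum_g.tendsto_sum_nat).comp (Filter.tendsto_add_atTop_nat 1)
  have h2 := (h1.const_sub (∑ n ∈ Finset.Ioc 0 t, (g n : ℝ) / (n : ℝ) ^ 3)).abs
  refine le_of_tendsto h2 ?_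
  filter_upwards [Filter.eventually_ge_atTop t] with N hN
  have e1 : ∑ n ∈ Finset.range (N + 1), (g n : ℝ) / (n : ℝ) ^ 3
      = ∑ n ∈ Finset.Ioc 0 t, (g n : ℝ) / (n : ℝ) ^ 3
        + ∑ n ∈ Finset.Ioc t N, (g n : ℝ) / (n : ℝ) ^ 3 := by
    rw [Finset.sum_Ioc_consecutive _ (by omega) hN, Finset.sum_range_succ', Finset.range_eq_Ico,
      Finset.sum_Ico_add' (fun n : ℕ => (g n : ℝ) / (n : ℝ) ^ 3) 0 N 1]
    simp
    rfl
  simp only [Function.comp]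
  rw [e1, sub_add_cancel_left, abs_neg]
  refine (Finset.abs_sum_le_sum_abs _ _).trans ?_
  have h3 := sum_Ioc_inv_sq_le_sub (α := ℝ) ht.ne' hN
  have h4 : (0 : ℝ) ≤ (N : ℝ)⁻¹ := by positivity
  rw [one_div]
  refine le_trans (Finset.sum_le_sum fun n hn => ?_) (h3.trans (by linarith))
  have hn0 : (0 : ℝ) < n := by
    have := (Finset.mem_Ioc.1 hn).1
    exact_mod_cast (by omega : 0 < n)
  rw [abs_div, abs_of_pos (pow_pos hn0 3), div_le_iff₀ (pow_pos hn0 3)]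
  refine (abs_g_le' n).trans (le_of_eq ?_)
  field_simp

lemma main_bound (t : ℕ) (ht : 2 ≤ t) :
    |(Hper t : ℝ) - 2 * zeta3 / Real.pi ^ 2 * (t : ℝ) ^ 3| ≤ 10 * (t : ℝ) ^ 2 * Real.log t := by
  have ht0 : (0 : ℝ) < t := by exact_mod_cast (by omega : 0 < t)
  have hH : (Hper t : ℝ) =
      ∑ n ∈ Finset.Ioc 0 t, (g n : ℝ) * ∑ m ∈ Finset.Ioc 0 (t / n), (m : ℝ) ^ 2 := by
    exact_mod_cast congrArg (fun z : ℤ => (z : ℝ)) (Hper_eq' t)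
  have e : (Hper t : ℝ) - 2 * zeta3 / Real.pi ^ 2 * (t : ℝ) ^ 3 =
      ∑ n ∈ Finset.Ioc 0 t, (g n : ℝ) *
        (∑ m ∈ Finset.Ioc 0 (t / n), (m : ℝ) ^ 2 - ((t : ℝ) / n) ^ 3 / 3)
      + (t : ℝ) ^ 3 / 3 *
        (∑ n ∈ Finset.Ioc 0 t, (g n : ℝ) / (n : ℝ) ^ 3 - zeta3 * (6 / Real.pi ^ 2)) := by
    have : ∑ n ∈ Finset.Ioc 0 t, (g n : ℝ) * (((t : ℝ) / n) ^ 3 / 3)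
        = (t : ℝ) ^ 3 / 3 * ∑ n ∈ Finset.Ioc 0 t, (g n : ℝ) / (n : ℝ) ^ 3 := by
      rw [Finset.mul_sum]
      refine Finset.sum_congr rfl fun n _ => ?_
      rw [div_pow]; ring
    simp only [mul_sub, Finset.sum_sub_distrib]
    rw [this, hH]; ring
  have b1 : |∑ n ∈ Finset.Ioc 0 t, (g n : ℝ) *
        (∑ m ∈ Finset.Ioc 0 (t / n), (m : ℝ) ^ 2 - ((t : ℝ) / n) ^ 3 / 3)|
      ≤ 3 * (t : ℝ) ^ 2 * (1 + Real.log t) := by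
    refine (Finset.abs_sum_le_sum_abs _ _).trans ?_
    have hh := harmonic_le_one_add_log t
    rw [harmonic_eq_sum_Icc] at hh
    push_cast at hh
    refine le_trans ?_ (mul_le_mul_of_nonneg_left hh (by positivity))
    rw [Finset.mul_sum]
    refine Finset.sum_le_sum fun n hn => ?_
    have hn' := Finset.mem_Ioc.1 hn
    have hn0 : (0 : ℝ) < n := by exact_mod_cast hn'.1
    rw [abs_mul]
    refine (mul_le_mul (abs_g_le' n) (sum_sq_bound t n hn'.1 hn'.2) (abs_nonneg _)
      hn0.le).trans (le_of_eq ?_)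
    field_simp
  have b2 : |(t : ℝ) ^ 3 / 3 *
        (∑ n ∈ Finset.Ioc 0 t, (g n : ℝ) / (n : ℝ) ^ 3 - zeta3 * (6 / Real.pi ^ 2))|
      ≤ (t : ℝ) ^ 2 / 3 := by
    rw [abs_mul, abs_of_pos (by positivity)]
    refine (mul_le_mul_of_nonneg_left (tail t (by omega)) (by positivity)).trans (le_of_eq ?_)
    field_simp
  have hlog : (0.69 : ℝ) ≤ Real.log t := by
    have := Real.log_two_gt_d9
    have h2 : Real.log 2 ≤ Real.log t := Real.log_le_log (by norm_num) (by exact_mod_cast ht)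
    linarith
  rw [e]
  refine (abs_add_le _ _).trans ((add_le_add b1 b2).trans ?_)
  nlinarith [pow_pos ht0 2]

lemma zeta3_pos : 0 < zeta3 := by
  have hs : Summable (fun n : ℕ => 1 / ((n : ℝ) + 1) ^ 3) := by
    have := (summable_nat_add_iff (f := fun n : ℕ => 1 / (n : ℝ) ^ 3) 1).2
      (Real.summable_one_div_nat_pow.2 (by norm_num))
    simpa using this
  exact hs.tsum_pos (fun n => by positivity) 0 (by norm_num)

end HperAux

/-- `H_t = (2ζ(3)/π²)·t³ + O(t² log t)`; in particular `H_t ~ (2ζ(3)/π²)·t³`. -/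
theorem Hper_asymptotics :
    (∃ C : ℝ, 0 < C ∧ ∀ t : ℕ, 2 ≤ t →
      |(Hper t : ℝ) - 2 * zeta3 / Real.pi ^ 2 * (t : ℝ) ^ 3|
        ≤ C * (t : ℝ) ^ 2 * Real.log t) ∧
    Filter.Tendsto (fun t : ℕ => (Hper t : ℝ) / (2 * zeta3 / Real.pi ^ 2 * (t : ℝ) ^ 3))
      Filter.atTop (nhds 1) := by
  refine ⟨⟨10, by norm_num, HperAux.main_bound⟩, ?_⟩
  have hc : 0 < 2 * zeta3 / Real.pi ^ 2 := by
    have := HperAux.zeta3_pos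
    positivity
  have hb := HperAux.main_bound
  generalize 2 * zeta3 / Real.pi ^ 2 = c at hc hb ⊢
  rw [tendsto_iff_norm_sub_tendsto_zero]
  have hl : Filter.Tendsto (fun t : ℕ => 10 / c * (Real.log t / t)) Filter.atTop (nhds 0) := by
    have h1 : Filter.Tendsto (fun x : ℝ => Real.log x / x) Filter.atTop (nhds 0) :=
      Real.isLittleO_log_id_atTop.tendsto_div_nhds_zero
    simpa using (h1.comp tendsto_natCast_atTop_atTop).const_mul (10 / c)
  refine squeeze_zero' (Filter.Eventually.of_forall fun t => norm_nonneg _) ?_ hl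
  filter_upwards [Filter.eventually_ge_atTop 2] with t ht
  have ht0 : (0 : ℝ) < t := by exact_mod_cast (by omega : 0 < t)
  have h1 := hb t ht
  have hpos : 0 < c * (t : ℝ) ^ 3 := by positivity
  rw [Real.norm_eq_abs, div_sub_one hpos.ne', abs_div, abs_of_pos hpos, div_le_iff₀ hpos]
  refine h1.trans (le_of_eq ?_)
  field_simp
end
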